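/- Let u : Ω → [−1,1] be a minimizer of J(v,Ω) = ∫_Ω (|∇v|^p + W(v)) dx with u(0) = 0. Then there exist constants δ > 0 and R₀ > 0, depending only on n, p, m, λ, Λ, such that for every R ≥ R₀ with B_R ⊆ Ω one has |B_R ∩ {u ≥ 0}| ≥ δ·R^n. -/

import Mathlib

open MeasureTheory Metric Set

noncomputable section

/-- `v` is locally Lipschitz at every point of `Ω`. -/
def LocLipOn {n : ℕ} (Ω : Set (EuclideanSpace ℝ (Fin n)))
    (v : EuclideanSpace ℝ (Fin n) → ℝ) : Prop :=
  ∀ x ∈ Ω, ∃ K : NNReal, ∃ U ∈ nhds x, LipschitzOnWith K v U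

/-- The energy `J(v,A) = ∫_A (|∇v|^p + W(v)) dx`. -/
def JW {n : ℕ} (p : ℝ) (W : ℝ → ℝ) (v : EuclideanSpace ℝ (Fin n) → ℝ)
    (A : Set (EuclideanSpace ℝ (Fin n))) : ℝ :=
  ∫ x in A, (‖gradient v x‖ ^ p + W (v x))

/-- `u` minimizes `JW p W` in `Ω` among `[-1,1]`-valued locally Lipschitz competitors. -/
def IsMinOfJW {n : ℕ} (p : ℝ) (W : ℝ → ℝ) (Ω : Set (EuclideanSpace ℝ (Fin n)))
    (u : EuclideanSpace ℝ (Fin n) → ℝ) : Prop :=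
  ∀ Ω' : Set (EuclideanSpace ℝ (Fin n)), IsOpen Ω' → Bornology.IsBounded Ω' →
    closure Ω' ⊆ Ω →
    ∀ v : EuclideanSpace ℝ (Fin n) → ℝ,
      (∀ x, v x ∈ Icc (-1 : ℝ) 1) → LocLipOn Ω v →
      (∀ x ∈ Ω \ Ω', v x = u x) →
      JW p W u Ω' ≤ JW p W v Ω'

/-- The structural assumptions on the double-well potential `W`
(as in Theorem 3.1 of the paper). -/
def IsAdmissiblePotential (m lam Lam : ℝ) (W : ℝ → ℝ) : Prop :=
  ContDiffOn ℝ 1 W (Ioo (-1 : ℝ) 1) ∧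
  (∀ τ ∈ Ioo (-1 : ℝ) 1, 0 < W τ) ∧
  (∀ τ ∈ Ioo (-1 : ℝ) 1,
    lam ≤ W τ / (1 - τ ^ 2) ^ m ∧ W τ / (1 - τ ^ 2) ^ m ≤ Lam) ∧
  (∀ τ : ℝ, 1 / 2 < |τ| → |τ| < 1 →
    lam ≤ -(deriv W τ) * Real.sign τ / (1 - τ ^ 2) ^ (m - 1) ∧
    -(deriv W τ) * Real.sign τ / (1 - τ ^ 2) ^ (m - 1) ≤ Lam) ∧
  W (-1) = 0 ∧ W 1 = 0

section

open Filter Topology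

/-- One-dimensional Sobolev bound: a compactly supported Lipschitz function is controlled by the
integral of its derivative. -/
lemma LipschitzWith.enorm_le_lintegral_enorm_deriv {K : NNReal} {f : ℝ → ℝ}
    (hf : LipschitzWith K f) (hs : HasCompactSupport f) (x : ℝ) :
    ‖f x‖ₑ ≤ ∫⁻ t, ‖deriv f t‖ₑ := by
  obtain ⟨a, hax, ha⟩ : ∃ a ≤ x, f a = 0 := by
    have hb := (hs.isCompact.isBounded).bddBelow
    obtain ⟨b, hb⟩ := hb
    refine ⟨min x (b - 1), min_le_left _ _, ?_⟩
    by_contra h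
    have := hb (subset_tsupport f h)
    have := min_le_right x (b - 1)
    linarith
  have h1 := (hf.lipschitzOnWith (s := uIcc a x)).absolutelyContinuousOnInterval.integral_deriv_eq_sub
  rw [ha, sub_zero, intervalIntegral.integral_of_le hax] at h1
  rw [← h1]
  calc ‖∫ t in Ioc a x, deriv f t‖ₑ ≤ ∫⁻ t in Ioc a x, ‖deriv f t‖ₑ :=
        enorm_integral_le_lintegral_enorm _
    _ ≤ ∫⁻ t, ‖deriv f t‖ₑ := setLIntegral_le_lintegral _ _

lemma deriv_comp_update_eq_lineDeriv {n : ℕ} (u : (Fin n → ℝ) → ℝ) (x : Fin n → ℝ) (i : Fin n)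
    (y : ℝ) :
    deriv (u ∘ Function.update x i) y = lineDeriv ℝ u (Function.update x i y) (Pi.single i 1) := by
  unfold lineDeriv
  have h : (fun t : ℝ ↦ u (Function.update x i y + t • Pi.single i 1))
      = fun t ↦ (u ∘ Function.update x i) (y + t) := by
    ext t
    simp only [Function.comp]
    congr 1
    ext j
    by_cases h : j = i
    · subst h; simp
    · simp [h]
  rw [h, deriv_comp_const_add, add_zero]

/-- Gagliardo–Nirenberg–Sobolev inequality for Lipschitz functions on `Fin n → ℝ`. -/
lemma LipschitzWith.lintegral_pow_le_pow_lintegral_lineDeriv {n : ℕ} {p : ℝ}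
    (hp : Real.HolderConjugate n p) {K : NNReal} {u : (Fin n → ℝ) → ℝ}
    (hu : LipschitzWith K u) (hs : HasCompactSupport u) :
    ∫⁻ x, ‖u x‖ₑ ^ p ≤ (∫⁻ x, ∑ i, ‖lineDeriv ℝ u x (Pi.single i 1)‖ₑ) ^ p := by
  have hcard : Real.HolderConjugate (Fintype.card (Fin n)) p := by simpa using hp
  have hn : (1 : ℝ) ≤ (n : ℝ) - 1 := by
    have : (2 : ℝ) ≤ n := by exact_mod_cast hp.lt
    linarith
  have hm : Measurable fun x ↦ ∑ i : Fin n, ‖lineDeriv ℝ u x (Pi.single i 1)‖ₑ :=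
    Finset.measurable_fun_sum _ fun i _ ↦ (measurable_lineDeriv hu.continuous).enorm
  calc ∫⁻ x, ‖u x‖ₑ ^ p = ∫⁻ x, (‖u x‖ₑ ^ (1 / ((n : ℝ) - 1))) ^ (n : ℝ) := by
        congr! 2 with x
        rw [← ENNReal.rpow_mul, hp.conjugate_eq]
        field_simp
    _ = ∫⁻ x, ∏ _i : Fin n, ‖u x‖ₑ ^ (1 / ((n : ℝ) - 1)) := by
        simp_rw [Finset.prod_const, Finset.card_univ, Fintype.card_fin, ENNReal.rpow_natCast]
    _ ≤ ∫⁻ x, ∏ i : Fin n, (∫⁻ t, ∑ j, ‖lineDeriv ℝ u (Function.update x i t)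
          (Pi.single j 1)‖ₑ) ^ ((1 : ℝ) / ((n : ℝ) - 1)) := by
        gcongr with x i
        have hl : LipschitzWith (K * 1) (u ∘ Function.update x i) :=
          hu.comp (LipschitzWith.of_dist_le_mul fun a b ↦ by
            rw [dist_pi_le_iff (by positivity)]
            intro j
            by_cases h : j = i
            · subst h; simp
            · simp [h])
        refine (hl.enorm_le_lintegral_enorm_deriv
          (hs.comp_isClosedEmbedding (Topology.IsClosedEmbedding.mk
            (isClosedEmbedding_update x i).isEmbedding
            (isClosedEmbedding_update x i).isClosed_range)) (x i) |>.trans' (by simp)).trans ?_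
        gcongr with t
        rw [deriv_comp_update_eq_lineDeriv]
        exact Finset.single_le_sum (f := fun j ↦ ‖lineDeriv ℝ u (Function.update x i t)
          (Pi.single j 1)‖ₑ) (fun _ _ ↦ zero_le) (Finset.mem_univ i)
    _ ≤ _ := by
        have := lintegral_prod_lintegral_pow_le (fun _ : Fin n ↦ (volume : Measure ℝ)) hcard hm
        simpa [volume_pi] using this

lemma enorm_lineDeriv_toLp_le {n : ℕ} {ψ : EuclideanSpace ℝ (Fin n) → ℝ} {x : Fin n → ℝ}
    (h : DifferentiableAt ℝ ψ (WithLp.toLp 2 x)) (i : Fin n) :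
    ‖lineDeriv ℝ (fun y ↦ ψ (WithLp.toLp 2 y)) x (Pi.single i 1)‖ₑ
      ≤ ‖fderiv ℝ ψ (WithLp.toLp 2 x)‖ₑ := by
  have h1 : lineDeriv ℝ (fun y ↦ ψ (WithLp.toLp 2 y)) x (Pi.single i 1)
      = lineDeriv ℝ ψ (WithLp.toLp 2 x) (WithLp.toLp 2 (Pi.single i 1)) := rfl
  rw [h1, h.lineDeriv_eq_fderiv]
  refine (ContinuousLinearMap.le_opENorm _ _).trans ?_
  have : ‖(WithLp.toLp 2 (Pi.single i (1:ℝ)) : EuclideanSpace ℝ (Fin n))‖ₑ = 1 := by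
    have : ‖(EuclideanSpace.single i (1:ℝ) : EuclideanSpace ℝ (Fin n))‖ₑ = 1 := by
      rw [← ofReal_norm]; simp
    exact this
  rw [this, mul_one]

/-- Superlevel set form of the Sobolev inequality for Lipschitz functions. -/
lemma LipschitzWith.pow_mul_volume_pow_le {n : ℕ} (hn : 2 ≤ n) {K : NNReal}
    {ψ : EuclideanSpace ℝ (Fin n) → ℝ} (hψ : LipschitzWith K ψ) (hs : HasCompactSupport ψ)
    {c : ℝ} (hc : 0 < c) {S : Set (EuclideanSpace ℝ (Fin n))} (hS : ∀ x ∈ S, c ≤ ψ x) :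
    c ^ n * volume.real S ^ (n - 1) ≤ (n * ∫ x, ‖fderiv ℝ ψ x‖) ^ n := by
  have hn1 : (1 : ℝ) ≤ (n : ℝ) - 1 := by
    have : (2 : ℝ) ≤ n := by exact_mod_cast hn
    linarith
  set p : ℝ := n / (n - 1) with hp
  have hp0 : 0 < p := by positivity
  have hH : Real.HolderConjugate n p := Real.HolderConjugate.conjExponent (by linarith)
  have mp := PiLp.volume_preserving_toLp (Fin n)
  have hl : LipschitzWith (K * (Fintype.card (Fin n) : NNReal) ^ (1 / (2:ENNReal)).toReal)
      (fun y : Fin n → ℝ ↦ ψ (WithLp.toLp 2 y)) := by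
    have := PiLp.lipschitzWith_toLp 2 (fun _ : Fin n ↦ ℝ)
    exact hψ.comp this
  have hcs : HasCompactSupport (fun y : Fin n → ℝ ↦ ψ (WithLp.toLp 2 y)) :=
    hs.comp_homeomorph (PiLp.continuousLinearEquiv 2 ℝ (fun _ : Fin n ↦ ℝ)).symm.toHomeomorph
  have hme : MeasurableEmbedding (WithLp.toLp 2 : (Fin n → ℝ) → EuclideanSpace ℝ (Fin n)) :=
    (MeasurableEquiv.toLp 2 (Fin n → ℝ)).measurableEmbedding
  have h1 := hl.lintegral_pow_le_pow_lintegral_lineDeriv hH hcs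
  have h2 : ∫⁻ x : Fin n → ℝ, ∑ i, ‖lineDeriv ℝ (fun y ↦ ψ (WithLp.toLp 2 y)) x (Pi.single i 1)‖ₑ
      ≤ n * ∫⁻ x, ‖fderiv ℝ ψ x‖ₑ := by
    rw [← mp.lintegral_comp_emb hme, ← lintegral_const_mul' _ _ (by simp)]
    refine lintegral_mono_ae ?_
    have := mp.quasiMeasurePreserving.ae hψ.ae_differentiableAt
    filter_upwards [this] with x hx
    calc _ ≤ ∑ i : Fin n, ‖fderiv ℝ ψ (WithLp.toLp 2 x)‖ₑ :=
          Finset.sum_le_sum fun i _ ↦ enorm_lineDeriv_toLp_le hx i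
      _ = _ := by simp
  have h3 : ∫⁻ y : Fin n → ℝ, ‖ψ (WithLp.toLp 2 y)‖ₑ ^ p = ∫⁻ x, ‖ψ x‖ₑ ^ p :=
    mp.lintegral_comp_emb hme (fun x ↦ ‖ψ x‖ₑ ^ p)
  have h4 : ENNReal.ofReal c ^ p * volume S ≤ ∫⁻ x, ‖ψ x‖ₑ ^ p := by
    refine le_trans ?_ (mul_meas_ge_le_lintegral₀
      (hψ.continuous.measurable.enorm.pow_const p).aemeasurable (ENNReal.ofReal c ^ p))
    gcongr
    intro x hx
    rw [Set.mem_ofPred_eq]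
    gcongr
    rw [← ofReal_norm]
    exact ENNReal.ofReal_le_ofReal ((hS x hx).trans (le_abs_self _))
  have hint : Integrable (fun x ↦ ‖fderiv ℝ ψ x‖) := by
    have hsupp : Function.support (fun x ↦ ‖fderiv ℝ ψ x‖) ⊆ tsupport ψ := by
      intro x hx
      exact support_fderiv_subset ℝ (by simpa using hx)
    rw [← integrableOn_iff_integrable_of_support_subset hsupp]
    refine Measure.integrableOn_of_bounded (M := K) hs.isCompact.measure_lt_top.ne
      (measurable_fderiv ℝ ψ).norm.aestronglyMeasurable ?_
    filter_upwards with x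
    simpa using norm_fderiv_le_of_lipschitz ℝ hψ
  have h5 : ∫⁻ x, ‖fderiv ℝ ψ x‖ₑ = ENNReal.ofReal (∫ x, ‖fderiv ℝ ψ x‖) := by
    rw [ofReal_integral_eq_lintegral_ofReal hint (by filter_upwards with x; positivity)]
    simp [ofReal_norm]
  have h6 : ENNReal.ofReal c ^ p * volume S ≤ ENNReal.ofReal (n * ∫ x, ‖fderiv ℝ ψ x‖) ^ p := by
    rw [ENNReal.ofReal_mul (by positivity), ← h5, ENNReal.ofReal_natCast]
    exact h4.trans ((h3 ▸ h1).trans (ENNReal.rpow_le_rpow h2 hp0.le))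
  have hI : 0 ≤ n * ∫ x, ‖fderiv ℝ ψ x‖ := by positivity
  have h7 : c ^ p * volume.real S ≤ (n * ∫ x, ‖fderiv ℝ ψ x‖) ^ p := by
    have := ENNReal.toReal_mono
      (ENNReal.rpow_ne_top_of_nonneg hp0.le ENNReal.ofReal_ne_top) h6
    rw [ENNReal.toReal_mul, ← ENNReal.toReal_rpow, ← ENNReal.toReal_rpow,
      ENNReal.toReal_ofReal hc.le, ENNReal.toReal_ofReal hI] at this
    exact this
  have hpn : p * ((n - 1 : ℕ) : ℝ) = n := by
    rw [Nat.cast_sub (by lia), Nat.cast_one, hp]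
    field_simp
  have h8 := pow_le_pow_left₀ (by positivity) h7 (n - 1)
  rw [mul_pow, ← Real.rpow_natCast (c ^ p), ← Real.rpow_mul hc.le, hpn,
    ← Real.rpow_natCast ((n * ∫ x, ‖fderiv ℝ ψ x‖) ^ p), ← Real.rpow_mul hI, hpn,
    Real.rpow_natCast, Real.rpow_natCast] at h8
  exact h8

/-- Dilation form of integration by parts for Lipschitz functions. -/
lemma LipschitzWith.integral_fderiv_apply_self {n : ℕ} {K : NNReal}
    {ψ : EuclideanSpace ℝ (Fin n) → ℝ} (hψ : LipschitzWith K ψ) (hs : HasCompactSupport ψ) :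
    ∫ x, fderiv ℝ ψ x x = -(n * ∫ x, ψ x) := by
  let b := EuclideanSpace.basisFun (Fin n) ℝ
  have hcoord (i : Fin n) :
      LipschitzWith 1 (fun x : EuclideanSpace ℝ (Fin n) ↦ x i) :=
    LipschitzWith.of_dist_le_mul fun x y ↦ by
      simpa [Real.dist_eq, dist_eq_norm] using PiLp.norm_apply_le (x - y) i
  have h1 (i : Fin n) : ∫ x, lineDeriv ℝ ψ x (-(b i)) * x i = ∫ x, ψ x := by
    rw [← (hcoord i).integral_lineDeriv_mul_eq hψ hs (b i)]
    congr 1 with x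
    have : lineDeriv ℝ (fun x : EuclideanSpace ℝ (Fin n) ↦ x i) x (b i) = 1 := by
      have := ((EuclideanSpace.proj (𝕜 := ℝ) i).hasFDerivAt (x := x)).hasLineDerivAt (b i)
      simpa [b] using this.lineDeriv
    rw [this, one_mul]
  have h2 : ∀ᵐ x, fderiv ℝ ψ x x = ∑ i, -(lineDeriv ℝ ψ x (-(b i)) * x i) := by
    filter_upwards [hψ.ae_differentiableAt] with x hx
    rw [← congrArg (fderiv ℝ ψ x) (b.sum_repr x)]
    simp only [map_sum, map_smul, smul_eq_mul, hx.lineDeriv_eq_fderiv, map_neg]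
    refine Finset.sum_congr rfl fun i _ ↦ ?_
    simp [b]
    ring
  have hint (i : Fin n) : Integrable (fun x ↦ lineDeriv ℝ ψ x (-(b i)) * x i) := by
    have hsupp : Function.support (fun x ↦ lineDeriv ℝ ψ x (-(b i)) * x i) ⊆ tsupport ψ := by
      intro x hx
      by_contra h
      have h0 : ψ =ᶠ[𝓝 x] fun _ ↦ (0 : ℝ) := notMem_tsupport_iff_eventuallyEq.1 h
      apply hx
      have : lineDeriv ℝ ψ x (-(b i)) = 0 := by rw [h0.lineDeriv_eq]; simp [lineDeriv]
      simp only [this, zero_mul]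
    rw [← integrableOn_iff_integrable_of_support_subset hsupp]
    have hc : IntegrableOn (fun x : EuclideanSpace ℝ (Fin n) ↦ x i) (tsupport ψ) :=
      (hcoord i).continuous.continuousOn.integrableOn_compact hs.isCompact
    refine Integrable.bdd_mul (c := K * ‖-(b i)‖) hc
      (measurable_lineDeriv hψ.continuous).aestronglyMeasurable ?_
    filter_upwards with x using norm_lineDeriv_le_of_lipschitz ℝ hψ
  simp_rw [Finset.sum_neg_distrib] at h2
  rw [integral_congr_ae h2, integral_neg, integral_finsetSum _ fun i _ ↦ hint i]
  simp [h1]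

lemma norm_fderiv_le_add_of_eventually {E : Type*} [NormedAddCommGroup E] [NormedSpace ℝ E]
    {ψ f g : E → ℝ} {x : E} {c : ℝ} (hc : 0 ≤ c) (hψ : DifferentiableAt ℝ ψ x)
    (hf : DifferentiableAt ℝ f x) (hg : DifferentiableAt ℝ g x)
    (h : ∀ᶠ y in 𝓝 x, |ψ y - ψ x| ≤ |f y - f x| + c * |g y - g x|) :
    ‖fderiv ℝ ψ x‖ ≤ ‖fderiv ℝ f x‖ + c * ‖fderiv ℝ g x‖ := by
  refine ContinuousLinearMap.opNorm_le_bound _ (by positivity) fun v ↦ ?_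
  have key : |fderiv ℝ ψ x v| ≤ |fderiv ℝ f x v| + c * |fderiv ℝ g x v| := by
    have l1 := (hψ.hasFDerivAt.hasLineDerivAt v).tendsto_slope_zero_right.abs
    have l2 := (hf.hasFDerivAt.hasLineDerivAt v).tendsto_slope_zero_right.abs
    have l3 := (hg.hasFDerivAt.hasLineDerivAt v).tendsto_slope_zero_right.abs
    refine le_of_tendsto_of_tendsto l1 (l2.add (l3.const_mul c)) ?_
    have ht : Tendsto (fun t : ℝ ↦ x + t • v) (𝓝[>] 0) (𝓝 x) := by
      have : Tendsto (fun t : ℝ ↦ x + t • v) (𝓝 0) (𝓝 (x + (0:ℝ) • v)) :=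
        (by fun_prop : Continuous fun t : ℝ ↦ x + t • v).tendsto 0
      simp only [zero_smul, add_zero] at this
      exact this.mono_left nhdsWithin_le_nhds
    filter_upwards [ht.eventually h] with t hb
    simp only [smul_eq_mul, abs_mul]
    have : 0 ≤ |t⁻¹| := abs_nonneg _
    nlinarith
  calc ‖fderiv ℝ ψ x v‖ ≤ ‖fderiv ℝ f x v‖ + c * ‖fderiv ℝ g x v‖ := key
    _ ≤ ‖fderiv ℝ f x‖ * ‖v‖ + c * (‖fderiv ℝ g x‖ * ‖v‖) := by
        gcongr <;> exact ContinuousLinearMap.le_opNorm _ _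
    _ = _ := by ring

lemma rpow_convex_excess_nonneg {p : ℝ} (hp : 1 < p) {T B : ℝ} (hT : 0 ≤ T) (hB : 0 ≤ B) :
    0 ≤ T ^ p - B ^ p - p * B ^ (p - 1) * (T - B) := by
  rcases hB.eq_or_lt with rfl | hB
  · rw [Real.zero_rpow (by linarith), Real.zero_rpow (by linarith)]
    have := Real.rpow_nonneg hT p
    simpa
  have h := one_add_mul_self_le_rpow_one_add (s := T / B - 1) (by
    have : 0 ≤ T / B := by positivity
    linarith) hp.le
  rw [add_sub_cancel, Real.div_rpow hT hB.le, le_div_iff₀ (by positivity)] at h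
  have hb : B ^ p = B ^ (p - 1) * B := by
    rw [← Real.rpow_add_one hB.ne', sub_add_cancel]
  have : (1 + p * (T / B - 1)) * B ^ p = B ^ p + p * B ^ (p - 1) * (T - B) := by
    rw [hb]; field_simp
  linarith

lemma exists_rpow_convex_excess_ge {p : ℝ} (hp : 1 < p) :
    ∃ C > (0 : ℝ), ∀ T B : ℝ, 0 ≤ T → 0 ≤ B →
      T ^ p / 2 - C * B ^ p ≤ T ^ p - B ^ p - p * B ^ (p - 1) * (T - B) := by
  have hp1 : 0 < p - 1 := by linarith
  set M : ℝ := (2 * p) ^ (1 / (p - 1)) with hM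
  have hM0 : 0 < M := by positivity
  have hMp : M ^ (p - 1) = 2 * p := by
    rw [hM, ← Real.rpow_mul (by positivity), one_div, inv_mul_cancel₀ hp1.ne', Real.rpow_one]
  have hsplit {B : ℝ} (hB : 0 ≤ B) : B ^ p = B ^ (p - 1) * B := by
    rw [← Real.rpow_add_one' hB (by linarith), sub_add_cancel]
  refine ⟨p * M, by positivity, fun T B hT hB ↦ ?_⟩
  have hb := hsplit hB
  have ht := hsplit hT
  have hBp : 0 ≤ B ^ (p - 1) := by positivity
  have hTp : 0 ≤ T ^ (p - 1) := by positivity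
  suffices p * B ^ (p - 1) * T ≤ T ^ p / 2 + p * M * B ^ p by
    have : 0 ≤ (p - 1) * B ^ p := by positivity
    nlinarith
  rcases le_total T (M * B) with h | h
  · have h1 : p * B ^ (p - 1) * T ≤ p * B ^ (p - 1) * (M * B) := by gcongr
    have : 0 ≤ T ^ p := by positivity
    rw [hb]; nlinarith
  · have h1 : M ^ (p - 1) * B ^ (p - 1) ≤ T ^ (p - 1) := by
      rw [← Real.mul_rpow hM0.le hB]; gcongr
    rw [hMp] at h1
    have : 0 ≤ p * M * B ^ p := by positivity
    nlinarith

namespace IsAdmissiblePotential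

variable {m lam Lam : ℝ} {W : ℝ → ℝ}

lemma mul_rpow_le (h : IsAdmissiblePotential m lam Lam W) (hm : 0 < m) {τ : ℝ}
    (hτ : τ ∈ Icc (-1 : ℝ) 1) : lam * (1 - τ ^ 2) ^ m ≤ W τ := by
  obtain ⟨-, -, h3, -, h5, h6⟩ := h
  rcases hτ.1.eq_or_lt with rfl | h1
  · simp [h5, Real.zero_rpow hm.ne']
  rcases hτ.2.eq_or_lt with rfl | h2
  · simp [h6, Real.zero_rpow hm.ne']
  have : 0 < 1 - τ ^ 2 := by nlinarith
  have := (h3 τ ⟨h1, h2⟩).1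
  rwa [le_div_iff₀ (by positivity)] at this

lemma le_mul_rpow (h : IsAdmissiblePotential m lam Lam W) (hm : 0 < m) {τ : ℝ}
    (hτ : τ ∈ Icc (-1 : ℝ) 1) : W τ ≤ Lam * (1 - τ ^ 2) ^ m := by
  obtain ⟨-, -, h3, -, h5, h6⟩ := h
  rcases hτ.1.eq_or_lt with rfl | h1
  · simp [h5, Real.zero_rpow hm.ne']
  rcases hτ.2.eq_or_lt with rfl | h2
  · simp [h6, Real.zero_rpow hm.ne']
  have : 0 < 1 - τ ^ 2 := by nlinarith
  have := (h3 τ ⟨h1, h2⟩).2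
  rwa [div_le_iff₀ (by positivity)] at this

lemma nonneg (h : IsAdmissiblePotential m lam Lam W) (hm : 0 < m) (hlam : 0 < lam) {τ : ℝ}
    (hτ : τ ∈ Icc (-1 : ℝ) 1) : 0 ≤ W τ := by
  refine le_trans ?_ (h.mul_rpow_le hm hτ)
  have : 0 ≤ 1 - τ ^ 2 := by nlinarith [hτ.1, hτ.2]
  positivity

lemma le_const (h : IsAdmissiblePotential m lam Lam W) (hm : 0 < m) (hLam : 0 < Lam) {τ : ℝ}
    (hτ : τ ∈ Icc (-1 : ℝ) 1) : W τ ≤ Lam := by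
  refine (h.le_mul_rpow hm hτ).trans (mul_le_of_le_one_right hLam.le ?_)
  exact Real.rpow_le_one (by nlinarith [hτ.1, hτ.2]) (by nlinarith) hm.le

lemma le_one_add_rpow (h : IsAdmissiblePotential m lam Lam W) (hm : 0 < m) (hLam : 0 < Lam) {τ : ℝ}
    (hτ : τ ∈ Icc (-1 : ℝ) 1) : W τ ≤ Lam * 2 ^ m * (1 + τ) ^ m := by
  refine (h.le_mul_rpow hm hτ).trans ?_
  rw [mul_assoc, ← Real.mul_rpow (by norm_num) (by linarith [hτ.1])]
  gcongr
  · nlinarith [hτ.1, hτ.2]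
  · nlinarith [hτ.1, hτ.2]

lemma continuousOn (h : IsAdmissiblePotential m lam Lam W) (hm : 0 < m) (hlam : 0 < lam) :
    ContinuousOn W (Icc (-1) 1) := by
  have hsq (a : ℝ) (ha : a ^ 2 = 1) (hW : W a = 0) : ContinuousWithinAt W (Icc (-1) 1) a := by
    have hc : Tendsto (fun τ : ℝ ↦ Lam * (1 - τ ^ 2) ^ m) (𝓝[Icc (-1) 1] a) (𝓝 0) := by
      have : ContinuousAt (fun τ : ℝ ↦ Lam * (1 - τ ^ 2) ^ m) a :=
        continuousAt_const.mul (ContinuousAt.rpow_const (by fun_prop) (Or.inr hm.le))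
      have := this.tendsto
      simp only [ha, sub_self, Real.zero_rpow hm.ne', mul_zero] at this
      exact this.mono_left nhdsWithin_le_nhds
    unfold ContinuousWithinAt
    rw [hW]
    refine tendsto_of_tendsto_of_tendsto_of_le_of_le' tendsto_const_nhds hc ?_ ?_
    · filter_upwards [self_mem_nhdsWithin] with τ hτ using h.nonneg hm hlam hτ
    · filter_upwards [self_mem_nhdsWithin] with τ hτ using h.le_mul_rpow hm hτ
  intro τ hτ
  rcases hτ.1.eq_or_lt with rfl | h1
  · exact hsq _ (by norm_num) h.2.2.2.2.1
  rcases hτ.2.eq_or_lt with rfl | h2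
  · exact hsq _ (by norm_num) h.2.2.2.2.2
  exact (h.1.continuousOn.continuousAt (Ioo_mem_nhds h1 h2)).continuousWithinAt

lemma le_sub (h : IsAdmissiblePotential m lam Lam W) (hm : 1 < m) (hlam : 0 < lam) {a b : ℝ}
    (ha : -1 ≤ a) (hab : a ≤ b) (hb : b ≤ -(1 / 2)) :
    lam / m * ((1 + b) ^ m - (1 + a) ^ m) ≤ W b - W a := by
  have hmono : MonotoneOn (fun τ ↦ W τ - lam / m * (1 + τ) ^ m) (Icc a b) := by
    have hd (τ : ℝ) (hτ : τ ∈ Ioo a b) : HasDerivAt (fun τ ↦ W τ - lam / m * (1 + τ) ^ m)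
        (deriv W τ - lam / m * (m * (1 + τ) ^ (m - 1))) τ := by
      have h1 : HasDerivAt W (deriv W τ) τ :=
        ((h.1.differentiableOn one_ne_zero).differentiableAt
          (Ioo_mem_nhds (by linarith [hτ.1]) (by linarith [hτ.2]))).hasDerivAt
      have h2 : HasDerivAt (fun τ : ℝ ↦ (1 + τ) ^ m) (m * (1 + τ) ^ (m - 1)) τ := by
        simpa using ((hasDerivAt_id τ).const_add 1).rpow_const (p := m)
          (Or.inl (by simp only [id]; linarith [hτ.1]))
      exact h1.sub (h2.const_mul _)
    refine monotoneOn_of_deriv_nonneg (convex_Icc a b) ?_ ?_ ?_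
    · refine ((h.continuousOn (by linarith) hlam).mono
        (Icc_subset_Icc ha (by linarith))).sub ?_
      exact (ContinuousOn.rpow_const (by fun_prop) fun _ _ ↦ Or.inr (by linarith)).const_mul _
    · rw [interior_Icc]
      exact fun τ hτ ↦ (hd τ hτ).differentiableAt.differentiableWithinAt
    · rw [interior_Icc]
      intro τ hτ
      rw [(hd τ hτ).deriv]
      have hτ1 : -1 < τ := by linarith [hτ.1]
      have hτ2 : τ < -(1 / 2) := by linarith [hτ.2]
      have h4 := (h.2.2.2.1 τ (by rw [abs_of_neg (by linarith)]; linarith)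
        (by rw [abs_of_neg (by linarith)]; linarith)).1
      rw [Real.sign_of_neg (by linarith), le_div_iff₀
        (Real.rpow_pos_of_pos (by nlinarith) _)] at h4
      have h5 : (1 + τ) ^ (m - 1) ≤ (1 - τ ^ 2) ^ (m - 1) := by
        gcongr
        · linarith
        · nlinarith
      have : lam / m * (m * (1 + τ) ^ (m - 1)) = lam * (1 + τ) ^ (m - 1) := by
        field_simp
      nlinarith
  have := hmono (left_mem_Icc.2 hab) (right_mem_Icc.2 hab) hab
  simp only at this
  linarith

end IsAdmissiblePotential

lemma exists_lipschitzWith_rpow_comp {X : Type*} [PseudoMetricSpace X] {S : X → ℝ} {K : NNReal}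
    (hS : LipschitzWith K S) {a b : ℝ} (ha : 0 < a) (h : ∀ x, S x ∈ Icc a b) (e : ℝ) :
    ∃ K', LipschitzWith K' fun x ↦ S x ^ e := by
  have hc : ContDiffOn ℝ 1 (fun s : ℝ ↦ s ^ e) (Icc a b) := fun s hs ↦
    (Real.contDiffAt_rpow_const_of_ne (ha.trans_le hs.1).ne').contDiffWithinAt
  obtain ⟨C, hC⟩ := hc.exists_lipschitzOnWith one_ne_zero (convex_Icc a b) isCompact_Icc
  exact ⟨C * K, lipschitzOnWith_univ.1
    (hC.comp (hS.lipschitzOnWith (s := univ)) fun x _ ↦ h x)⟩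

lemma exists_lipschitzWith_min_norm_rpow {E : Type*} [SeminormedAddCommGroup E] {P : ℝ}
    (hP : 1 ≤ P) (ρ : ℝ) (hρ : 0 ≤ ρ) :
    ∃ K, LipschitzWith K fun x : E ↦ (min ‖x‖ ρ) ^ P := by
  have hc : ContDiffOn ℝ 1 (fun s : ℝ ↦ s ^ P) (Icc 0 ρ) :=
    (Real.contDiff_rpow_const_of_le (n := 1) (by exact_mod_cast hP)).contDiffOn
  obtain ⟨C, hC⟩ := hc.exists_lipschitzOnWith one_ne_zero (convex_Icc 0 ρ) isCompact_Icc
  exact ⟨C * 1, lipschitzOnWith_univ.1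
    (hC.comp ((lipschitzWith_one_norm.min_const ρ).lipschitzOnWith (s := univ)) fun x _ ↦
      ⟨le_min (norm_nonneg x) hρ, min_le_right _ _⟩)⟩

/-- A radial barrier: `η = 1 + h` where `h` is a strict supersolution of the `p`-Laplace equation
with right-hand side `κ (1 + h) ^ (m - 1)`; `g x • x` is the field `|∇h| ^ (p - 2) ∇h`. -/
lemma exists_barrier (n : ℕ) {p m κ : ℝ} (hp : 1 < p) (hpm : p < m) (hκ : 0 < κ) :
    ∃ A > 0, ∀ ρ > 0, ∃ η g : EuclideanSpace ℝ (Fin n) → ℝ,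
      (∃ K, LipschitzWith K η) ∧ (∃ K, LipschitzWith K g) ∧ (∀ x, 0 < η x ∧ η x ≤ 2) ∧
      (∃ M, ∀ x, 0 ≤ g x ∧ g x ≤ M) ∧ (∀ x, ρ ≤ ‖x‖ → η x = 2) ∧
      (∀ x, ‖x‖ < ρ → η x ≤ A * (ρ - ‖x‖) ^ (-(p / (m - p)))) ∧
      ∀ x, η x < 2 → x ≠ 0 → DifferentiableAt ℝ η x ∧ DifferentiableAt ℝ g x ∧
        fderiv ℝ η x x = ‖fderiv ℝ η x‖ * ‖x‖ ∧ ‖fderiv ℝ η x‖ ^ (p - 1) = g x * ‖x‖ ∧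
        ‖fderiv ℝ η x‖ ^ p ≤ η x ^ m ∧ p * (n * g x + fderiv ℝ g x x) ≤ κ * η x ^ (m - 1) := by
  have hp1 : 0 < p - 1 := by linarith
  have hmp : 0 < m - p := by linarith
  obtain ⟨q, hq⟩ : ∃ q, q = p / (m - p) := ⟨_, rfl⟩
  obtain ⟨P, hP⟩ : ∃ P, P = p / (p - 1) := ⟨_, rfl⟩
  obtain ⟨β, hβ⟩ : ∃ β, β = (q + 1) * (p - 1) := ⟨_, rfl⟩
  have hq0 : 0 < q := hq ▸ by positivity
  have hP1 : 1 < P := by rw [hP, lt_div_iff₀ hp1]; linarith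
  have hβ0 : 0 < β := hβ ▸ by positivity
  have hPp : (P - 1) * (p - 1) = 1 := by rw [hP]; field_simp; ring
  have hqm : (q + 1) * p = q * m := by rw [hq]; field_simp; ring
  have hβq : β + 1 = q * (m - 1) := by rw [hβ]; linarith
  obtain ⟨D, hD⟩ : ∃ D, D = (q * P) ^ p + p * (q * P) ^ (p - 1) * (n + β * P) / κ := ⟨_, rfl⟩
  have hD0 : 0 < D := hD ▸ by positivity
  obtain ⟨A, hA⟩ : ∃ A, A = D ^ (1 / (m - p)) := ⟨_, rfl⟩
  have hA0 : 0 < A := hA ▸ by positivity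
  have hAD : A ^ (m - p) = D := by
    rw [hA, ← Real.rpow_mul hD0.le, one_div_mul_cancel hmp.ne', Real.rpow_one]
  have hD1 : (q * P) ^ p ≤ A ^ (m - p) := by
    rw [hAD, hD]; exact le_add_of_nonneg_right (by positivity)
  have hD2 : p * (q * P) ^ (p - 1) * (n + β * P) ≤ κ * A ^ (m - p) := by
    have : κ * D = κ * (q * P) ^ p + p * (q * P) ^ (p - 1) * (n + β * P) := by
      rw [hD]; field_simp
    rw [hAD, this]
    exact le_add_of_nonneg_left (by positivity)
  obtain ⟨s, hs⟩ : ∃ s, s = (A / 2) ^ (1 / q) := ⟨_, rfl⟩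
  have hs0 : 0 < s := hs ▸ by positivity
  have hsA : A * s ^ (-q) = 2 := by
    rw [hs, ← Real.rpow_mul (by positivity), show 1 / q * -q = -1 by field_simp,
      Real.rpow_neg_one]
    field_simp
  refine ⟨A, hA0, fun ρ hρ ↦ ?_⟩
  obtain ⟨c, hc⟩ : ∃ c, c = ρ ^ (1 - P) := ⟨_, rfl⟩
  have hc0 : 0 < c := hc ▸ by positivity
  obtain ⟨S, hSdef⟩ : ∃ S : EuclideanSpace ℝ (Fin n) → ℝ,
      S = fun x ↦ max (ρ - c * (min ‖x‖ ρ) ^ P) s := ⟨_, rfl⟩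
  obtain ⟨G, hG⟩ : ∃ G, G = (A * q * P) ^ (p - 1) / ρ := ⟨_, rfl⟩
  have hG0 : 0 < G := hG ▸ by positivity
  have hX (x : EuclideanSpace ℝ (Fin n)) (hx : ‖x‖ ≤ ρ) :
      c * ‖x‖ ^ (P - 1) ≤ 1 ∧ (c * ‖x‖ ^ (P - 1)) ^ (p - 1) = ‖x‖ / ρ ∧
      c * ‖x‖ ^ P = c * ‖x‖ ^ (P - 1) * ‖x‖ := by
    have h1 : c * ‖x‖ ^ (P - 1) = (‖x‖ / ρ) ^ (P - 1) := by
      rw [Real.div_rpow (norm_nonneg x) hρ.le, hc, show (1 - P) = -(P - 1) by ring,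
        Real.rpow_neg hρ.le]
      ring
    refine ⟨?_, ?_, ?_⟩
    · rw [h1]
      exact Real.rpow_le_one (by positivity) ((div_le_one hρ).2 hx) (by linarith)
    · rw [h1, ← Real.rpow_mul (by positivity), hPp, Real.rpow_one]
    · rw [mul_assoc, ← Real.rpow_add_one' (norm_nonneg x) (by linarith)]; simp
  have hSs (x) : s ≤ S x := by rw [hSdef]; exact le_max_right _ _
  have hS0 (x) : 0 < S x := hs0.trans_le (hSs x)
  have hSρ (x) : S x ≤ max ρ s := by
    rw [hSdef]
    refine max_le_max ?_ le_rfl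
    have : 0 ≤ min ‖x‖ ρ := le_min (norm_nonneg x) hρ.le
    have : 0 ≤ c * (min ‖x‖ ρ) ^ P := by positivity
    linarith
  obtain ⟨K, hK⟩ := exists_lipschitzWith_min_norm_rpow (E := EuclideanSpace ℝ (Fin n)) hP1.le ρ hρ.le
  have hSL : ∃ K', LipschitzWith K' S :=
    ⟨_, hSdef ▸ ((LipschitzWith.const ρ).sub ((lipschitzWith_smul c).comp hK)).max_const s⟩
  obtain ⟨K', hK'⟩ := hSL
  have hη2 (x) : A * S x ^ (-q) ≤ 2 := by
    rw [← hsA]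
    exact mul_le_mul_of_nonneg_left
      (Real.rpow_le_rpow_of_nonpos hs0 (hSs x) (by linarith)) hA0.le
  refine ⟨fun x ↦ A * S x ^ (-q), fun x ↦ G * S x ^ (-β), ?_, ?_, fun x ↦ ⟨?_, hη2 x⟩,
    ⟨G * s ^ (-β), fun x ↦ ⟨?_, ?_⟩⟩, fun x hx ↦ ?_, fun x hx ↦ ?_, fun x hx hx0 ↦ ?_⟩
  · obtain ⟨L, hL⟩ := exists_lipschitzWith_rpow_comp hK' hs0 (fun x ↦ ⟨hSs x, hSρ x⟩) (-q)
    exact ⟨_, (lipschitzWith_smul A).comp hL⟩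
  · obtain ⟨L, hL⟩ := exists_lipschitzWith_rpow_comp hK' hs0 (fun x ↦ ⟨hSs x, hSρ x⟩) (-β)
    exact ⟨_, (lipschitzWith_smul G).comp hL⟩
  · have := hS0 x
    positivity
  · have := hS0 x
    positivity
  · exact mul_le_mul_of_nonneg_left
      (Real.rpow_le_rpow_of_nonpos hs0 (hSs x) (by linarith)) hG0.le
  · have : S x = s := by
      rw [hSdef]
      simp only [min_eq_right hx]
      rw [max_eq_right]
      have : c * ρ ^ P = ρ := by
        rw [hc, ← Real.rpow_add hρ]; simp
      linarith
    simp only [this, hsA]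
  · rw [← hq]
    refine mul_le_mul_of_nonneg_left
      (Real.rpow_le_rpow_of_nonpos (by linarith) ?_ (by linarith)) hA0.le
    rw [hSdef]
    refine le_trans ?_ (le_max_left _ _)
    rw [min_eq_left hx.le, (hX x hx.le).2.2]
    have := mul_le_of_le_one_left (norm_nonneg x) (hX x hx.le).1
    linarith
  · have hSx : s < S x := by
      refine (hSs x).lt_of_ne fun h ↦ hx.ne ?_
      simp only [← h, hsA]
    have hxρ : ‖x‖ < ρ := by
      by_contra! h
      have : c * ρ ^ P = ρ := by
        rw [hc, ← Real.rpow_add hρ]; simp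
      rw [hSdef] at hSx
      simp only [min_eq_right h, this, sub_self] at hSx
      rw [max_eq_right hs0.le] at hSx
      exact hSx.false
    have hev : S =ᶠ[𝓝 x] fun y ↦ ρ - c * ‖y‖ ^ P := by
      filter_upwards [continuous_norm.continuousAt.eventually_lt_const hxρ,
        hK'.continuous.continuousAt.eventually_const_lt hSx] with y hy1 hy2
      rw [hSdef] at hy2 ⊢
      simp only [min_eq_left hy1.le] at hy2 ⊢
      rcases lt_max_iff.1 hy2 with h | h
      · exact max_eq_left h.le
      · exact absurd h (lt_irrefl _)
    have hSeq := hev.eq_of_nhds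
    have hxn : 0 < ‖x‖ := norm_pos_iff.2 hx0
    have hSρ' : S x ≤ ρ := by
      rw [hSeq]
      have : 0 ≤ c * ‖x‖ ^ P := by positivity
      linarith
    have hSd : HasFDerivAt S (-(c • ((P * ‖x‖ ^ (P - 2)) • innerSL ℝ x))) x := by
      have := ((hasFDerivAt_norm_rpow x hP1).const_mul c).const_sub ρ
      exact this.congr_of_eventuallyEq hev
    obtain ⟨X, hXdef⟩ : ∃ X, X = c * ‖x‖ ^ (P - 1) := ⟨_, rfl⟩
    obtain ⟨hX1, hX2, -⟩ := hX x hxρ.le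
    rw [← hXdef] at hX1 hX2
    have hX0 : 0 ≤ X := hXdef ▸ by positivity
    have hXk : c * (P * ‖x‖ ^ (P - 2)) = P * X / ‖x‖ := by
      rw [hXdef, show P - 1 = P - 2 + 1 by ring, Real.rpow_add_one hxn.ne']
      field_simp
    have hpow (e : ℝ) : HasFDerivAt (fun y ↦ S y ^ (-e))
        ((e * S x ^ (-e - 1) * (P * X / ‖x‖)) • innerSL ℝ x) x := by
      have := hSd.rpow_const (p := -e) (Or.inl (hS0 x).ne')
      rw [smul_neg, smul_smul, smul_smul, mul_assoc _ c, hXk] at this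
      rwa [show e * S x ^ (-e - 1) * (P * X / ‖x‖) = -(-e * S x ^ (-e - 1) * (P * X / ‖x‖)) by
        ring, neg_smul]
    have hηd := (hpow q).const_mul A
    have hgd := (hpow β).const_mul G
    have hSx0 := hS0 x
    have hnorm : ‖fderiv ℝ (fun x ↦ A * S x ^ (-q)) x‖ = A * q * P * S x ^ (-q - 1) * X := by
      rw [hηd.fderiv, norm_smul, norm_smul, innerSL_apply_norm, Real.norm_of_nonneg hA0.le,
        Real.norm_of_nonneg (by positivity)]
      field_simp
    refine ⟨hηd.differentiableAt, hgd.differentiableAt, ?_, ?_, ?_, ?_⟩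
    · rw [hnorm, hηd.fderiv]
      simp only [smul_apply, innerSL_apply_apply, real_inner_self_eq_norm_sq,
        smul_eq_mul]
      field_simp
    · rw [hnorm, Real.mul_rpow (by positivity) hX0, hX2, Real.mul_rpow (by positivity)
        (by positivity), ← Real.rpow_mul hSx0.le, hG, hβ,
        show (-q - 1) * (p - 1) = -((q + 1) * (p - 1)) by ring]
      ring
    · rw [hnorm]
      calc (A * q * P * S x ^ (-q - 1) * X) ^ p ≤ (A * q * P * S x ^ (-q - 1)) ^ p := by
            refine Real.rpow_le_rpow (by positivity) ?_ (by linarith)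
            exact mul_le_of_le_one_right (by positivity) hX1
        _ = A ^ p * (q * P) ^ p * S x ^ (-(q * m)) := by
            rw [Real.mul_rpow (by positivity) (by positivity), ← Real.rpow_mul hSx0.le,
              mul_assoc A, Real.mul_rpow hA0.le (by positivity), ← hqm]
            congr 2; ring
        _ ≤ A ^ p * A ^ (m - p) * S x ^ (-(q * m)) := by gcongr
        _ = (A * S x ^ (-q)) ^ m := by
            rw [Real.mul_rpow hA0.le (by positivity), ← Real.rpow_mul hSx0.le,
              ← Real.rpow_add hA0]
            congr 2 <;> ring
    · have hg' : fderiv ℝ (fun x ↦ G * S x ^ (-β)) x x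
          = G * (β * P * S x ^ (-β - 1) * (X * ‖x‖)) := by
        rw [hgd.fderiv]
        simp only [smul_apply, innerSL_apply_apply,
          real_inner_self_eq_norm_sq, smul_eq_mul]
        field_simp
      have hSβ : S x ^ (-β) = S x ^ (-β - 1) * S x := by
        rw [← Real.rpow_add_one hSx0.ne']; simp
      simp only [hg', hSβ]
      have hXρ : X * ‖x‖ ≤ ρ := (mul_le_of_le_one_left hxn.le hX1).trans hxρ.le
      calc p * (n * (G * (S x ^ (-β - 1) * S x)) + G * (β * P * S x ^ (-β - 1) * (X * ‖x‖)))
          ≤ p * (n * (G * (S x ^ (-β - 1) * ρ)) + G * (β * P * S x ^ (-β - 1) * ρ)) := by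
            gcongr
        _ = A ^ (p - 1) * (p * (q * P) ^ (p - 1) * (n + β * P)) * S x ^ (-β - 1) := by
            rw [hG, mul_assoc A, Real.mul_rpow hA0.le (by positivity)]
            field_simp
        _ ≤ A ^ (p - 1) * (κ * A ^ (m - p)) * S x ^ (-β - 1) := by gcongr
        _ = κ * (A * S x ^ (-q)) ^ (m - 1) := by
            rw [Real.mul_rpow hA0.le (by positivity), ← Real.rpow_mul hSx0.le,
              show -β - 1 = -q * (m - 1) by linarith, show m - 1 = p - 1 + (m - p) by ring,
              Real.rpow_add hA0]
            ring

lemma LipschitzWith.integrableOn_norm_fderiv_rpow {E : Type*} [NormedAddCommGroup E]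
    [NormedSpace ℝ E] [MeasurableSpace E] [BorelSpace E] {μ : Measure E} {K : NNReal} {φ : E → ℝ}
    (hφ : LipschitzWith K φ) {p : ℝ} (hp : 0 ≤ p) {S : Set E} (hS : μ S ≠ ⊤) :
    IntegrableOn (fun x ↦ ‖fderiv ℝ φ x‖ ^ p) S μ := by
  refine Measure.integrableOn_of_bounded (M := (K : ℝ) ^ p) hS
    ((measurable_fderiv ℝ φ).norm.pow_const p).aestronglyMeasurable (ae_of_all _ fun x ↦ ?_)
  rw [Real.norm_of_nonneg (by positivity)]
  exact Real.rpow_le_rpow (norm_nonneg _) (norm_fderiv_le_of_lipschitz ℝ hφ) hp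

lemma integrableOn_comp_of_continuousOn_compact {E : Type*} [TopologicalSpace E]
    [MeasurableSpace E] [OpensMeasurableSpace E] {μ : Measure E} {W : ℝ → ℝ} {k : Set ℝ}
    (hk : IsCompact k) (hW : ContinuousOn W k) {φ : E → ℝ} (hφ : Continuous φ)
    (hφk : ∀ x, φ x ∈ k) {S : Set E} (hS : μ S ≠ ⊤) : IntegrableOn (fun x ↦ W (φ x)) S μ := by
  obtain ⟨M, hM⟩ := hk.exists_bound_of_continuousOn hW
  exact Measure.integrableOn_of_bounded (M := M) hS
    (hW.comp_continuous hφ hφk).measurable.aestronglyMeasurable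
    (ae_of_all _ fun x ↦ hM _ (hφk x))

/-- One-sided minimality of a globally defined Lipschitz function in the ball of radius `r`. -/
def IsSubminimal {n : ℕ} (p : ℝ) (W : ℝ → ℝ) (U : EuclideanSpace ℝ (Fin n) → ℝ) (r : ℝ) : Prop :=
  ∀ φ : EuclideanSpace ℝ (Fin n) → ℝ, (∃ K, LipschitzWith K φ) → (∀ x, φ x ∈ Icc (-1 : ℝ) 1) →
    (∀ x, r ≤ ‖x‖ → φ x = 1) →
    ∫ x in {x | φ x < U x}, (‖fderiv ℝ U x‖ ^ p + W (U x)) ≤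
      ∫ x in {x | φ x < U x}, (‖fderiv ℝ φ x‖ ^ p + W (φ x))

lemma IsSubminimal.mono {n : ℕ} {p : ℝ} {W : ℝ → ℝ} {U : EuclideanSpace ℝ (Fin n) → ℝ} {r s : ℝ}
    (h : IsSubminimal p W U r) (hs : s ≤ r) : IsSubminimal p W U s :=
  fun φ h1 h2 h3 ↦ h φ h1 h2 fun x hx ↦ h3 x (hs.trans hx)

lemma norm_gradient {n : ℕ} (f : EuclideanSpace ℝ (Fin n) → ℝ) (x : EuclideanSpace ℝ (Fin n)) :
    ‖gradient f x‖ = ‖fderiv ℝ f x‖ := by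
  rw [gradient, LinearIsometryEquiv.norm_map]

lemma fderiv_min_eq_left {E : Type*} [NormedAddCommGroup E] [NormedSpace ℝ E] {f g : E → ℝ} {x : E}
    (hf : DifferentiableAt ℝ f x) (hm : DifferentiableAt ℝ (fun y ↦ min (f y) (g y)) x)
    (h : f x ≤ g x) : fderiv ℝ (fun y ↦ min (f y) (g y)) x = fderiv ℝ f x := by
  have hmin : IsLocalMin (fun y ↦ f y - min (f y) (g y)) x :=
    Eventually.of_forall fun y ↦ by
      simp only [min_eq_left h, sub_self]
      exact sub_nonneg.2 (min_le_left _ _)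
  have := hmin.fderiv_eq_zero
  rw [fderiv_fun_sub hf hm] at this
  exact (sub_eq_zero.1 this).symm

lemma IsMinOfJW.exists_isSubminimal {n : ℕ} {p : ℝ} (hp : 0 ≤ p) {W : ℝ → ℝ}
    (hW : ContinuousOn W (Icc (-1) 1)) {Ω : Set (EuclideanSpace ℝ (Fin n))}
    {u : EuclideanSpace ℝ (Fin n) → ℝ} (hu : ∀ x, u x ∈ Icc (-1 : ℝ) 1) (hL : LocLipOn Ω u)
    (hmin : IsMinOfJW p W Ω u) {r : ℝ} (hrΩ : closedBall 0 r ⊆ Ω) :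
    ∃ U : EuclideanSpace ℝ (Fin n) → ℝ, (∃ K, LipschitzWith K U) ∧ (∀ x, U x ∈ Icc (-1 : ℝ) 1) ∧
      (∀ x ∈ closedBall 0 r, U x = u x) ∧ IsSubminimal p W U r := by
  have hloc : LocallyLipschitzOn (closedBall 0 r) u := fun x hx ↦ by
    obtain ⟨K, t, ht, hK⟩ := hL x (hrΩ hx)
    exact ⟨K, t, mem_nhdsWithin_of_mem_nhds ht, hK⟩
  obtain ⟨K, hK⟩ := hloc.exists_lipschitzOnWith_of_compact (isCompact_closedBall 0 r)
  obtain ⟨f, hf, hfu⟩ := hK.extend_real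
  obtain ⟨U, hUL, hU1, hUu⟩ : ∃ U : EuclideanSpace ℝ (Fin n) → ℝ, LipschitzWith K U ∧
      (∀ x, U x ∈ Icc (-1 : ℝ) 1) ∧ ∀ x ∈ closedBall 0 r, U x = u x := by
    refine ⟨fun x ↦ max (min (f x) 1) (-1), (hf.min_const 1).max_const (-1), fun x ↦
      ⟨le_max_right _ _, max_le (min_le_right _ _) (by norm_num)⟩, fun x hx ↦ ?_⟩
    simp only [← hfu hx, min_eq_left (hu x).2, max_eq_left (hu x).1]
  refine ⟨U, ⟨K, hUL⟩, hU1, hUu, fun φ ⟨L, hφ⟩ hφ1 hφr ↦ ?_⟩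
  have hS : {x | φ x < U x} ⊆ ball 0 r := fun x hx ↦ by
    rw [mem_ball_zero_iff]
    by_contra! h
    have := (hU1 x).2
    rw [← hφr x h] at this
    exact this.not_gt hx
  have hSo : IsOpen {x | φ x < U x} := isOpen_lt hφ.continuous hUL.continuous
  have hmin' := hmin (ball 0 r) isOpen_ball isBounded_ball
    (closure_ball_subset_closedBall.trans hrΩ) (fun x ↦ min (u x) (φ x))
    (fun x ↦ ⟨le_min (hu x).1 (hφ1 x).1, (min_le_left _ _).trans (hu x).2⟩)
    (fun x hx ↦ by
      obtain ⟨M, t, ht, hM⟩ := hL x hx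
      refine ⟨max M L, t, ht, ?_⟩
      have := lipschitzWith_min.comp_lipschitzOnWith (hM.prodMk hφ.lipschitzOnWith)
      simpa [Function.comp_def] using this)
    (fun x hx ↦ min_eq_left <| by
      rw [hφr x (by simpa using hx.2)]; exact (hu x).2)
  have hV : LipschitzWith (max K L) fun x ↦ min (U x) (φ x) := hUL.min hφ
  have hV1 (x) : min (U x) (φ x) ∈ Icc (-1 : ℝ) 1 :=
    ⟨le_min (hU1 x).1 (hφ1 x).1, (min_le_left _ _).trans (hU1 x).2⟩
  have hfin : volume (ball (0 : EuclideanSpace ℝ (Fin n)) r) ≠ ⊤ := measure_ball_lt_top.ne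
  have hUev : ∀ x ∈ ball (0 : EuclideanSpace ℝ (Fin n)) r, u =ᶠ[𝓝 x] U := fun x hx ↦ by
    filter_upwards [isOpen_ball.mem_nhds hx] with y hy using (hUu y (ball_subset_closedBall hy)).symm
  have e1 : JW p W u (ball 0 r) = ∫ x in ball 0 r, (‖fderiv ℝ U x‖ ^ p + W (U x)) :=
    setIntegral_congr_fun measurableSet_ball fun x hx ↦ by
      simp only [norm_gradient, (hUev x hx).fderiv_eq, (hUev x hx).eq_of_nhds]
  have e2 : JW p W (fun x ↦ min (u x) (φ x)) (ball 0 r) =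
      ∫ x in ball 0 r, (‖fderiv ℝ (fun x ↦ min (U x) (φ x)) x‖ ^ p + W (min (U x) (φ x))) :=
    setIntegral_congr_fun measurableSet_ball fun x hx ↦ by
      have : (fun x ↦ min (u x) (φ x)) =ᶠ[𝓝 x] fun x ↦ min (U x) (φ x) :=
        (hUev x hx).comp₂ min EventuallyEq.rfl
      simp only [norm_gradient, this.fderiv_eq, (hUev x hx).eq_of_nhds]
  have i1 : IntegrableOn (fun x ↦ ‖fderiv ℝ U x‖ ^ p + W (U x)) (ball 0 r) :=
    (hUL.integrableOn_norm_fderiv_rpow hp hfin).add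
    (integrableOn_comp_of_continuousOn_compact isCompact_Icc hW hUL.continuous hU1 hfin)
  have i2 : IntegrableOn (fun x ↦ ‖fderiv ℝ (fun x ↦ min (U x) (φ x)) x‖ ^ p +
      W (min (U x) (φ x))) (ball 0 r) := (hV.integrableOn_norm_fderiv_rpow hp hfin).add
    (integrableOn_comp_of_continuousOn_compact isCompact_Icc hW hV.continuous hV1 hfin)
  rw [e1, e2, ← integral_inter_add_sdiff hSo.measurableSet i1,
    ← integral_inter_add_sdiff hSo.measurableSet i2, inter_eq_self_of_subset_right hS] at hmin'
  have e3 : ∫ x in ball 0 r \ {x | φ x < U x},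
        (‖fderiv ℝ (fun x ↦ min (U x) (φ x)) x‖ ^ p + W (min (U x) (φ x))) =
      ∫ x in ball 0 r \ {x | φ x < U x}, (‖fderiv ℝ U x‖ ^ p + W (U x)) := by
    refine setIntegral_congr_ae (measurableSet_ball.diff hSo.measurableSet) ?_
    filter_upwards [hUL.ae_differentiableAt, hV.ae_differentiableAt] with x h1 h2 hx
    have hle : U x ≤ φ x := not_lt.1 hx.2
    rw [fderiv_min_eq_left h1 h2 hle, min_eq_left hle]
  have e4 : ∫ x in {x | φ x < U x},
        (‖fderiv ℝ (fun x ↦ min (U x) (φ x)) x‖ ^ p + W (min (U x) (φ x))) =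
      ∫ x in {x | φ x < U x}, (‖fderiv ℝ φ x‖ ^ p + W (φ x)) :=
    setIntegral_congr_fun hSo.measurableSet fun x hx ↦ by
      have : (fun x ↦ min (U x) (φ x)) =ᶠ[𝓝 x] φ := by
        filter_upwards [hSo.mem_nhds hx] with y hy using min_eq_right (le_of_lt hy)
      simp only [this.fderiv_eq, this.eq_of_nhds]
  linarith

lemma integral_norm_fderiv_le_setIntegral {E : Type*} [NormedAddCommGroup E]
    [NormedSpace ℝ E] [MeasurableSpace E] {μ : Measure E}
    {ψ F : E → ℝ} (h0 : ∀ x, 0 ≤ ψ x) {S : Set E} (hS : MeasurableSet S)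
    (hψS : ∀ x, x ∉ S → ψ x = 0) (hF : IntegrableOn F S μ)
    (h : ∀ᵐ x ∂μ, x ∈ S → ‖fderiv ℝ ψ x‖ ≤ F x) :
    ∫ x, ‖fderiv ℝ ψ x‖ ∂μ ≤ ∫ x in S, F x ∂μ := by
  rw [← integral_indicator hS]
  refine integral_mono_of_nonneg (ae_of_all _ fun x ↦ norm_nonneg _)
    ((integrable_indicator_iff hS).2 hF) ?_
  filter_upwards [h] with x hx
  by_cases hxS : x ∈ S
  · simpa [hxS] using hx hxS
  · have : IsLocalMin ψ x := Eventually.of_forall fun y ↦ by rw [hψS x hxS]; exact h0 y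
    simp [hxS, this.fderiv_eq_zero]

lemma le_of_pow_le_mul_pow {n : ℕ} (hn : 2 ≤ n) {C b c : ℝ} (hC : 0 < C) (hb : 0 < b) (hc : 0 < c)
    (hcC : C ^ n * c * b ^ (n * (n - 1)) ≤ 1) {a : ℕ → ℝ} (ha : ∀ j, 0 ≤ a j) (ha0 : a 0 ≤ c)
    (h : ∀ j, a (j + 1) ^ (n - 1) ≤ (C * b ^ j * a j) ^ n) (j : ℕ) :
    a j ≤ c * ((b ^ n) ^ j)⁻¹ := by
  obtain ⟨k, rfl⟩ : ∃ k, n = k + 2 := ⟨n - 2, by omega⟩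
  simp only [show k + 2 - 1 = k + 1 from rfl] at *
  induction j with
  | zero => simpa using ha0
  | succ j ih =>
    refine le_of_pow_le_pow_left₀ (n := k + 1) (by omega) (by positivity) ((h j).trans ?_)
    calc (C * b ^ j * a j) ^ (k + 2)
        ≤ (C * b ^ j * (c * ((b ^ (k + 2)) ^ j)⁻¹)) ^ (k + 2) := by
          have := ha j
          gcongr
      _ = (C ^ (k + 2) * c * b ^ ((k + 2) * (k + 1))) *
            (c * ((b ^ (k + 2)) ^ (j + 1))⁻¹) ^ (k + 1) := by
          have h1 : (b ^ (k + 2)) ^ j = (b ^ j) ^ (k + 2) := by rw [← pow_mul, ← pow_mul, mul_comm]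
          have h2 : b ^ j * ((b ^ j) ^ (k + 2))⁻¹ = ((b ^ j) ^ (k + 1))⁻¹ := by
            field_simp; ring
          rw [pow_succ (b ^ (k + 2)) j, h1, pow_mul, mul_comm c ((b ^ j) ^ (k + 2))⁻¹,
            ← mul_assoc, mul_assoc C, h2]
          have hB : b ^ j ≠ 0 := by positivity
          have hD : b ^ (k + 2) ≠ 0 := by positivity
          generalize b ^ j = B at hB ⊢
          generalize b ^ (k + 2) = D at hD ⊢
          simp only [mul_pow, inv_pow, ← pow_mul]
          field_simp
          ring
      _ ≤ _ := mul_le_of_le_one_left (by positivity) hcC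

/-- The level-set inequality behind De Giorgi's iteration. -/
lemma IsSubminimal.level_set_estimate {n : ℕ} (hn : 2 ≤ n) {p : ℝ} (hp : 1 ≤ p) {W : ℝ → ℝ}
    (hW : ContinuousOn W (Icc (-1) 1)) {M : ℝ} (hM : 0 ≤ M)
    (hWM : ∀ τ ∈ Icc (-1 : ℝ) 1, 0 ≤ W τ ∧ W τ ≤ M)
    {U : EuclideanSpace ℝ (Fin n) → ℝ} {K : NNReal} (hU : LipschitzWith K U)
    (hU1 : ∀ x, U x ∈ Icc (-1 : ℝ) 1) {r : ℝ} (h : IsSubminimal p W U r) {k k' r₁ r₂ : ℝ}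
    (hk : -1 ≤ k) (hkk : k < k') (hk1 : k ≤ 1) (hr : r₁ < r₂) (hd : r₂ - r₁ ≤ 1) (hr₂ : r₂ ≤ r) :
    (k' - k) ^ n * volume.real ({x | k' < U x} ∩ ball 0 r₁) ^ (n - 1) ≤
      (n * ((2 ^ p + M + 3) * (r₂ - r₁) ^ (-p) * volume.real ({x | k < U x} ∩ ball 0 r₂))) ^ n := by
  have hd0 : 0 < r₂ - r₁ := by linarith
  obtain ⟨L, hL⟩ : ∃ L : ℝ, L = 2 / (r₂ - r₁) := ⟨_, rfl⟩
  have hL0 : 0 < L := hL ▸ by positivity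
  obtain ⟨φ, hφdef⟩ : ∃ φ : EuclideanSpace ℝ (Fin n) → ℝ,
      φ = fun x ↦ min (max (k + L * (‖x‖ - r₁)) k) 1 := ⟨_, rfl⟩
  have hφ : LipschitzWith L.toNNReal φ := by
    have h1 : LipschitzWith L.toNNReal fun x : EuclideanSpace ℝ (Fin n) ↦
        k + L * (‖x‖ - r₁) := LipschitzWith.of_dist_le_mul fun x y ↦ by
      rw [Real.dist_eq, Real.coe_toNNReal _ hL0.le, dist_eq_norm,
        show k + L * (‖x‖ - r₁) - (k + L * (‖y‖ - r₁)) = L * (‖x‖ - ‖y‖) by ring, abs_mul,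
        abs_of_pos hL0]
      exact mul_le_mul_of_nonneg_left (abs_norm_sub_norm_le x y) hL0.le
    rw [hφdef]
    exact (h1.max_const k).min_const 1
  have hφk (x) : k ≤ φ x := by
    rw [hφdef]
    exact le_min (le_max_right _ _) hk1
  have hφ1 (x) : φ x ∈ Icc (-1 : ℝ) 1 :=
    ⟨hk.trans (hφk x), by rw [hφdef]; exact min_le_right _ _⟩
  have hφr (x) (hx : r₂ ≤ ‖x‖) : φ x = 1 := by
    rw [hφdef]
    refine min_eq_right (le_max_of_le_left ?_)
    have : L * (r₂ - r₁) = 2 := by rw [hL]; field_simp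
    nlinarith
  have hφr₁ (x) (hx : ‖x‖ ≤ r₁) : φ x = k := by
    rw [hφdef]
    simp only
    rw [max_eq_right, min_eq_left hk1]
    nlinarith
  have hS : {x | φ x < U x} ⊆ {x | k < U x} ∩ ball 0 r₂ := fun x hx ↦ by
    refine ⟨(hφk x).trans_lt hx, ?_⟩
    rw [mem_ball_zero_iff]
    by_contra! hx2
    exact ((hU1 x).2.trans_eq (hφr x hx2).symm).not_gt hx
  have hSm : MeasurableSet {x | φ x < U x} :=
    (isOpen_lt hφ.continuous hU.continuous).measurableSet
  have hafin : volume ({x | k < U x} ∩ ball 0 r₂) ≠ ⊤ :=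
    measure_ne_top_of_subset inter_subset_right measure_ball_lt_top.ne
  have hSfin : volume {x | φ x < U x} ≠ ⊤ := measure_ne_top_of_subset hS hafin
  have hSr : volume.real {x | φ x < U x} ≤ volume.real ({x | k < U x} ∩ ball 0 r₂) :=
    measureReal_mono hS hafin
  have hp0 : 0 ≤ p := by linarith
  have iU := hU.integrableOn_norm_fderiv_rpow hp0 hSfin
  have iφ := hφ.integrableOn_norm_fderiv_rpow hp0 hSfin
  have iWU := integrableOn_comp_of_continuousOn_compact isCompact_Icc hW hU.continuous hU1 hSfin
  have iWφ := integrableOn_comp_of_continuousOn_compact isCompact_Icc hW hφ.continuous hφ1 hSfin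
  have ic (c : ℝ) : IntegrableOn (fun _ ↦ c) {x | φ x < U x} := integrableOn_const hSfin
  have hφd (x) : ‖fderiv ℝ φ x‖ ≤ L := by
    simpa [hL0.le] using norm_fderiv_le_of_lipschitz ℝ hφ (x₀ := x)
  have hmin := h φ ⟨_, hφ⟩ hφ1 fun x hx ↦ hφr x (hr₂.trans hx)
  have hgrad : ∫ x in {x | φ x < U x}, ‖fderiv ℝ U x‖ ^ p ≤
      (L ^ p + M) * volume.real {x | φ x < U x} := by
    calc _ ≤ ∫ x in {x | φ x < U x}, (‖fderiv ℝ U x‖ ^ p + W (U x)) :=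
          setIntegral_mono iU (iU.add iWU) fun x ↦ le_add_of_nonneg_right (hWM _ (hU1 x)).1
      _ ≤ _ := hmin
      _ ≤ ∫ x in {x | φ x < U x}, (L ^ p + M) :=
          setIntegral_mono (iφ.add iWφ) (ic _) fun x ↦
            add_le_add (Real.rpow_le_rpow (norm_nonneg _) (hφd x) hp0) (hWM _ (hφ1 x)).2
      _ = _ := by rw [setIntegral_const, smul_eq_mul, mul_comm]
  have hψ : LipschitzWith (K + L.toNNReal) fun x ↦ max (U x - φ x) 0 := (hU.sub hφ).max_const 0
  have hψS (x) (hx : x ∉ {x | φ x < U x}) : max (U x - φ x) 0 = 0 :=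
    max_eq_right (sub_nonpos.2 (not_lt.1 hx))
  have hsupp : HasCompactSupport fun x ↦ max (U x - φ x) 0 := by
    refine HasCompactSupport.intro (isCompact_closedBall 0 r₂) fun x hx ↦ hψS x fun hx' ↦ hx ?_
    exact ball_subset_closedBall (hS hx').2
  have hint : ∫ x, ‖fderiv ℝ (fun x ↦ max (U x - φ x) 0) x‖ ≤
      (L ^ p + M + (1 + L)) * volume.real {x | φ x < U x} := by
    calc _ ≤ ∫ x in {x | φ x < U x}, (‖fderiv ℝ U x‖ ^ p + (1 + L)) := by
          refine integral_norm_fderiv_le_setIntegral (fun x ↦ le_max_right _ _) hSm hψS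
            (iU.add (ic _)) ?_
          filter_upwards [hψ.ae_differentiableAt, hU.ae_differentiableAt,
            hφ.ae_differentiableAt] with x h1 h2 h3 _
          have := norm_fderiv_le_add_of_eventually zero_le_one h1 h2 h3 <|
            Eventually.of_forall fun y ↦ by
              calc |max (U y - φ y) 0 - max (U x - φ x) 0| ≤ |(U y - φ y) - (U x - φ x)| :=
                    abs_max_sub_max_le_abs _ _ _
                _ = |(U y - U x) - (φ y - φ x)| := by congr 1; ring
                _ ≤ _ := by rw [one_mul]; exact abs_sub _ _
          have h4 : ‖fderiv ℝ U x‖ ≤ ‖fderiv ℝ U x‖ ^ p + 1 := by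
            rcases le_total ‖fderiv ℝ U x‖ 1 with h | h
            · have : 0 ≤ ‖fderiv ℝ U x‖ ^ p := by positivity
              linarith
            · have := Real.self_le_rpow_of_one_le h hp
              linarith
          linarith [hφd x]
      _ ≤ _ := by
          rw [integral_add iU (ic _), setIntegral_const, smul_eq_mul]
          linarith
  have hLd : L ^ p + M + (1 + L) ≤ (2 ^ p + M + 3) * (r₂ - r₁) ^ (-p) := by
    have h1 : L ^ p = 2 ^ p * (r₂ - r₁) ^ (-p) := by
      rw [hL, Real.div_rpow (by norm_num) hd0.le, Real.rpow_neg hd0.le, div_eq_mul_inv]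
    have h2 : 1 ≤ (r₂ - r₁) ^ (-p) := Real.one_le_rpow_of_pos_of_le_one_of_nonpos hd0 hd (by linarith)
    have h3 : L ≤ 2 * (r₂ - r₁) ^ (-p) := by
      rw [hL, div_eq_mul_inv, ← Real.rpow_neg_one]
      exact mul_le_mul_of_nonneg_left
        (Real.rpow_le_rpow_of_exponent_ge hd0 hd (by linarith)) (by norm_num)
    nlinarith
  calc _ ≤ (k' - k) ^ n * volume.real ({x | k' < U x} ∩ ball 0 r₁) ^ (n - 1) := le_rfl
    _ ≤ (n * ∫ x, ‖fderiv ℝ (fun x ↦ max (U x - φ x) 0) x‖) ^ n := by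
        refine hψ.pow_mul_volume_pow_le hn hsupp (by linarith) fun x hx ↦ le_max_of_le_left ?_
        rw [hφr₁ x (mem_ball_zero_iff.1 hx.2).le]
        linarith [show k' < U x from hx.1]
    _ ≤ _ := by
        refine pow_le_pow_left₀ (by positivity) ?_ n
        refine mul_le_mul_of_nonneg_left ?_ (Nat.cast_nonneg n)
        calc _ ≤ _ := hint
          _ ≤ _ := mul_le_mul hLd hSr measureReal_nonneg (by positivity)

lemma exists_le_volume_unit_ball {n : ℕ} (hn : 2 ≤ n) {p : ℝ} (hp : 1 ≤ p) {M : ℝ} (hM : 0 ≤ M) :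
    ∃ c > 0, ∀ W : ℝ → ℝ, ContinuousOn W (Icc (-1) 1) →
      (∀ τ ∈ Icc (-1 : ℝ) 1, 0 ≤ W τ ∧ W τ ≤ M) →
      ∀ U : EuclideanSpace ℝ (Fin n) → ℝ, (∃ K, LipschitzWith K U) →
      (∀ x, U x ∈ Icc (-1 : ℝ) 1) → U 0 = 0 → IsSubminimal p W U 1 →
      c ≤ volume.real ({x | -(1 / 2) < U x} ∩ ball 0 1) := by
  obtain ⟨C, hC⟩ : ∃ C : ℝ, C = 8 * n * ((2 ^ p + M + 3) * 4 ^ p) := ⟨_, rfl⟩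
  have hn0 : (0 : ℝ) < n := by exact_mod_cast (by omega : 0 < n)
  have hC0 : 0 < C := hC ▸ by positivity
  obtain ⟨b, hb⟩ : ∃ b : ℝ, b = 2 * 2 ^ p := ⟨_, rfl⟩
  have hb1 : 1 < b := by
    have : (1 : ℝ) ≤ 2 ^ p := Real.one_le_rpow (by norm_num) (by linarith)
    linarith
  have hb0 : 0 < b := by linarith
  refine ⟨(C ^ n * b ^ (n * (n - 1)))⁻¹, by positivity, fun W hW hWM U ⟨K, hU⟩ hU1 hU0 h ↦ ?_⟩
  by_contra! hlt
  obtain ⟨k, hk⟩ : ∃ k : ℕ → ℝ, k = fun j ↦ -(1 / 4) - (1 / 4) * (1 / 2) ^ j := ⟨_, rfl⟩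
  obtain ⟨s, hs⟩ : ∃ s : ℕ → ℝ, s = fun j ↦ 1 / 2 + (1 / 2) * (1 / 2) ^ j := ⟨_, rfl⟩
  have hhalf (j : ℕ) : 0 < (1 / 2 : ℝ) ^ j ∧ (1 / 2 : ℝ) ^ j ≤ 1 :=
    ⟨by positivity, pow_le_one₀ (by norm_num) (by norm_num)⟩
  have hkd (j) : k (j + 1) - k j = (1 / 2) ^ j / 8 := by rw [hk]; ring
  have hsd (j) : s j - s (j + 1) = (1 / 2) ^ j / 4 := by rw [hs]; ring
  have hk1 (j) : -1 ≤ k j ∧ k j ≤ -(1 / 4) := by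
    rw [hk]; constructor <;> simp only <;> linarith [hhalf j]
  have hs1 (j) : 1 / 2 ≤ s j ∧ s j ≤ 1 := by
    rw [hs]; constructor <;> simp only <;> linarith [hhalf j]
  obtain ⟨a, ha⟩ : ∃ a : ℕ → ℝ, a = fun j ↦ volume.real ({x | k j < U x} ∩ ball 0 (s j)) :=
    ⟨_, rfl⟩
  have ha0 (j) : 0 ≤ a j := by rw [ha]; exact measureReal_nonneg
  have hrec (j) : a (j + 1) ^ (n - 1) ≤ (C * b ^ j * a j) ^ n := by
    have := h.level_set_estimate hn hp hW hM hWM hU hU1 (k := k j) (k' := k (j + 1))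
      (r₁ := s (j + 1)) (r₂ := s j) (hk1 j).1 (by linarith [hkd j, hhalf j])
      (by linarith [hk1 j]) (by linarith [hsd j, hhalf j]) (by linarith [hsd j, hhalf j]) (hs1 j).2
    have e1 : ((1 / 2 : ℝ) ^ j / 4) ^ (-p) = 4 ^ p * (2 ^ p) ^ j := by
      rw [show (1 / 2 : ℝ) ^ j / 4 = (4 * 2 ^ j)⁻¹ by rw [one_div, inv_pow]; field_simp,
        Real.inv_rpow (by positivity), Real.rpow_neg (by positivity), inv_inv,
        Real.mul_rpow (by norm_num) (by positivity), ← Real.rpow_natCast, ← Real.rpow_natCast,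
        ← Real.rpow_mul (by norm_num), ← Real.rpow_mul (by norm_num), mul_comm (j : ℝ) p]
    rw [hkd, hsd, e1] at this
    have e2 : ((1 / 2 : ℝ) ^ j / 8) ^ n * (8 * 2 ^ j) ^ n = 1 := by
      rw [← mul_pow, one_div, inv_pow]; field_simp; simp
    calc a (j + 1) ^ (n - 1)
        = (8 * 2 ^ j) ^ n * (((1 / 2 : ℝ) ^ j / 8) ^ n * a (j + 1) ^ (n - 1)) := by
          rw [← mul_assoc, mul_comm ((8 * 2 ^ j : ℝ) ^ n), e2, one_mul]
      _ ≤ (8 * 2 ^ j) ^ n * (n * ((2 ^ p + M + 3) * (4 ^ p * (2 ^ p) ^ j) * a j)) ^ n := by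
          rw [ha]
          exact mul_le_mul_of_nonneg_left this (by positivity)
      _ = (C * b ^ j * a j) ^ n := by
          rw [← mul_pow, hC, hb, mul_pow 2]
          congr 1
          ring
  have hdecay := le_of_pow_le_mul_pow hn hC0 hb0 (c := (C ^ n * b ^ (n * (n - 1)))⁻¹)
    (by positivity) (le_of_eq (by field_simp)) ha0 (by
      refine le_trans (le_of_eq ?_) hlt.le
      simp only [ha, hk, hs]
      norm_num) hrec
  have hV : volume.real ({x | -(1 / 4) < U x} ∩ ball 0 (1 / 2)) ≤ 0 := by
    have hbn : 1 < b ^ n := one_lt_pow₀ hb1 (by omega)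
    have hlim : Tendsto (fun j : ℕ ↦ (C ^ n * b ^ (n * (n - 1)))⁻¹ * ((b ^ n) ^ j)⁻¹) atTop
        (𝓝 ((C ^ n * b ^ (n * (n - 1)))⁻¹ * 0)) :=
      (tendsto_inv_atTop_zero.comp (tendsto_pow_atTop_atTop_of_one_lt hbn)).const_mul _
    rw [mul_zero] at hlim
    refine ge_of_tendsto' hlim fun j ↦ le_trans ?_ (hdecay j)
    rw [ha]
    refine measureReal_mono (inter_subset_inter (fun x hx ↦ ?_) (ball_subset_ball (hs1 j).1))
      (measure_ne_top_of_subset inter_subset_right measure_ball_lt_top.ne)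
    exact (hk1 j).2.trans_lt hx
  have hpos : 0 < volume.real ({x | -(1 / 4) < U x} ∩ ball 0 (1 / 2)) := by
    refine ENNReal.toReal_pos (IsOpen.measure_ne_zero _ ?_ ⟨0, ?_⟩)
      (measure_ne_top_of_subset inter_subset_right measure_ball_lt_top.ne)
    · exact (isOpen_lt continuous_const hU.continuous).inter isOpen_ball
    · simp [hU0]
  linarith

lemma le_rpow_add_one {t p : ℝ} (ht : 0 ≤ t) (hp : 1 ≤ p) : t ≤ t ^ p + 1 := by
  rcases le_total t 1 with h | h
  · have : 0 ≤ t ^ p := by positivity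
    linarith
  · have := Real.self_le_rpow_of_one_le h hp
    linarith

/-- Pointwise bounds for the energy excess of `u` over the barrier value `y - 1`. Here `T` and `B`
stand for the norms of the two gradients. -/
lemma exists_excess_bounds {p m lam Lam : ℝ} (hp : 1 < p) (hm : 1 < m) (hlam : 0 < lam)
    (hLam : 0 < Lam) :
    ∃ C > 0, ∀ W, IsAdmissiblePotential m lam Lam W → ∀ T B y u Q : ℝ, 0 ≤ T → 0 ≤ B → 0 < y →
      y ≤ 2 → u ∈ Icc (-1 : ℝ) 1 → y < 1 + u → B ^ p ≤ y ^ m →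
      T ^ p - B ^ p - p * B ^ (p - 1) * (T - B) + W u - W (y - 1)
        - lam / (2 * m) * y ^ (m - 1) * (1 + u - y) ≤ Q →
      (u ≤ -(1 / 2) → 0 ≤ Q ∧ (2 * y ≤ 1 + u → 1 / 4 ≤ 1 + u → T + 2 * B ≤ C * Q)) ∧
      -(C * y ^ (m - 1)) ≤ Q ∧ (1 / 8 ≤ y → 2 * B ≤ C * y ^ (m - 1)) := by
  obtain ⟨D, hD0, hD⟩ := exists_rpow_convex_excess_ge hp
  have hm0 : 0 < m := by linarith
  obtain ⟨ε, hε⟩ : ∃ ε, ε = min 1 (lam / (4 * m * D)) := ⟨_, rfl⟩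
  have hε0 : 0 < ε := hε ▸ lt_min one_pos (by positivity)
  have hε1 : ε ≤ 1 := hε ▸ min_le_left _ _
  have hεD : ε * D ≤ lam / (4 * m) := by
    have : ε ≤ lam / (4 * m * D) := hε ▸ min_le_right _ _
    calc ε * D ≤ lam / (4 * m * D) * D := by gcongr
      _ = _ := by field_simp
  obtain ⟨C₁, hC₁⟩ : ∃ C₁, C₁ = 2 / ε + (3 + 2 * 2 ^ m) * (8 * m * 4 ^ m / lam) := ⟨_, rfl⟩
  obtain ⟨C₂, hC₂⟩ : ∃ C₂, C₂ = Lam * 2 ^ m * 2 + lam / m := ⟨_, rfl⟩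
  obtain ⟨C₃, hC₃⟩ : ∃ C₃ : ℝ, C₃ = 2 * (2 + 8 ^ (m - 1)) := ⟨_, rfl⟩
  have hC₁0 : 0 < C₁ := hC₁ ▸ by positivity
  have hC₂0 : 0 < C₂ := hC₂ ▸ by positivity
  have hC₃0 : 0 < C₃ := hC₃ ▸ by positivity
  refine ⟨C₁ + C₂ + C₃, by positivity, fun W hW T B y u Q hT hB hy hy2 hu hyu hBy hQ ↦ ?_⟩
  have hE0 := rpow_convex_excess_nonneg hp hT hB
  have hE1 := hD T B hT hB
  obtain ⟨E, hE⟩ : ∃ E, E = T ^ p - B ^ p - p * B ^ (p - 1) * (T - B) := ⟨_, rfl⟩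
  rw [← hE] at hE0 hE1 hQ
  have hym : y ^ m = y ^ (m - 1) * y := by rw [← Real.rpow_add_one hy.ne']; simp
  have hym0 : 0 < y ^ (m - 1) := by positivity
  have hy1 : y - 1 ∈ Icc (-1 : ℝ) 1 := ⟨by linarith, by linarith⟩
  have hyI : y ^ m ≤ 2 * y ^ (m - 1) := by rw [hym]; nlinarith
  refine ⟨fun hu2 ↦ ?_, ?_, fun hy8 ↦ ?_⟩
  · have h1 := hW.le_sub hm hlam (a := y - 1) (b := u) hy1.1 (by linarith) hu2
    rw [add_sub_cancel] at h1
    have hum : (1 + u) ^ m = (1 + u) ^ (m - 1) * (1 + u) := by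
      rw [← Real.rpow_add_one (by linarith)]; simp
    have h2 : y ^ (m - 1) * (1 + u - y) ≤ (1 + u) ^ m - y ^ m := by
      have : y ^ (m - 1) ≤ (1 + u) ^ (m - 1) := Real.rpow_le_rpow hy.le hyu.le (by linarith)
      rw [hum, hym]
      nlinarith
    have h3 : lam / (2 * m) * y ^ (m - 1) * (1 + u - y) ≤
        lam / (2 * m) * ((1 + u) ^ m - y ^ m) := by
      rw [mul_assoc]
      exact mul_le_mul_of_nonneg_left h2 (by positivity)
    have h4 : lam / m = 2 * (lam / (2 * m)) := by field_simp
    have h5 : E + lam / (2 * m) * ((1 + u) ^ m - y ^ m) ≤ Q := by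
      rw [h4] at h1
      linarith
    have h6 : 0 ≤ (1 + u) ^ m - y ^ m :=
      sub_nonneg.2 (Real.rpow_le_rpow hy.le hyu.le hm0.le)
    have hQ0 : 0 ≤ Q := by
      have : 0 ≤ lam / (2 * m) * ((1 + u) ^ m - y ^ m) := by positivity
      linarith
    refine ⟨hQ0, fun h2y hu4 ↦ ?_⟩
    have h7 : y ^ m ≤ (1 + u) ^ m / 2 := by
      calc y ^ m ≤ ((1 + u) / 2) ^ m := Real.rpow_le_rpow hy.le (by linarith) hm0.le
        _ = (1 + u) ^ m / 2 ^ m := Real.div_rpow (by linarith) (by norm_num) _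
        _ ≤ (1 + u) ^ m / 2 := by
          have := Real.self_le_rpow_of_one_le (x := 2) (by norm_num) hm.le
          have : 0 < 1 + u := by linarith
          gcongr
    have h8 : (1 / 4 : ℝ) ^ m ≤ (1 + u) ^ m := Real.rpow_le_rpow (by norm_num) hu4 hm0.le
    have h9 : ε * (T ^ p / 2) - ε * D * ((1 + u) ^ m / 2) ≤ E := by
      have : ε * (T ^ p / 2 - D * B ^ p) ≤ E := by
        rcases le_total 0 (T ^ p / 2 - D * B ^ p) with h | h
        · exact (mul_le_of_le_one_left h hε1).trans hE1
        · exact (mul_nonpos_of_nonneg_of_nonpos hε0.le h).trans hE0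
      have : ε * D * B ^ p ≤ ε * D * ((1 + u) ^ m / 2) :=
        mul_le_mul_of_nonneg_left (hBy.trans h7) (by positivity)
      linarith
    have h10 : ε * D * ((1 + u) ^ m / 2) ≤ lam / (4 * m) * ((1 + u) ^ m / 2) := by
      have : 0 ≤ (1 + u) ^ m / 2 := by have : 0 < 1 + u := by linarith
                                       positivity
      gcongr
    have h11 : ε / 2 * T ^ p + lam / (8 * m) * (1 / 4) ^ m ≤ Q := by
      have e1 : lam / (2 * m) = 4 * (lam / (8 * m)) := by field_simp; norm_num
      have e2 : lam / (4 * m) = 2 * (lam / (8 * m)) := by field_simp; norm_num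
      have : 0 < lam / (8 * m) := by positivity
      rw [e1] at h5
      rw [e2] at h10
      have e3 := mul_le_mul_of_nonneg_left h7 this.le
      have e4 := mul_le_mul_of_nonneg_left h8 this.le
      linarith
    have h12 : T + 2 * B ≤ T ^ p + (3 + 2 * 2 ^ m) := by
      have := le_rpow_add_one hT hp.le
      have := le_rpow_add_one hB hp.le
      have : y ^ m ≤ 2 ^ m := Real.rpow_le_rpow hy.le hy2 hm0.le
      linarith
    have h13 : T ^ p + (3 + 2 * 2 ^ m) ≤ C₁ * Q := by
      have hT' : 0 ≤ T ^ p := by positivity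
      have e1 : 2 / ε * (ε / 2 * T ^ p) = T ^ p := by field_simp
      have e2 : 8 * m * 4 ^ m / lam * (lam / (8 * m) * (1 / 4) ^ m) = 1 := by
        rw [one_div, Real.inv_rpow (by norm_num)]
        field_simp
      have e3 : T ^ p ≤ 2 / ε * Q := by
        rw [← e1]
        refine mul_le_mul_of_nonneg_left (le_trans ?_ h11) (by positivity)
        exact le_add_of_nonneg_right (by positivity)
      have e4 : 1 ≤ 8 * m * 4 ^ m / lam * Q := by
        rw [← e2]
        refine mul_le_mul_of_nonneg_left (le_trans ?_ h11) (by positivity)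
        exact le_add_of_nonneg_left (by positivity)
      have : (3 + 2 * 2 ^ m) * 1 ≤ (3 + 2 * 2 ^ m) * (8 * m * 4 ^ m / lam * Q) :=
        mul_le_mul_of_nonneg_left e4 (by positivity)
      rw [hC₁]
      linarith
    have h14 : 0 ≤ (C₂ + C₃) * Q := by positivity
    linarith
  · have h1 := hW.le_one_add_rpow hm0 hLam hy1
    rw [add_sub_cancel] at h1
    have h2 := hW.nonneg hm0 hlam hu
    have h3 : Lam * 2 ^ m * y ^ m ≤ Lam * 2 ^ m * (2 * y ^ (m - 1)) := by gcongr
    have h4 : lam / (2 * m) * y ^ (m - 1) * (1 + u - y) ≤ lam / (2 * m) * y ^ (m - 1) * 2 :=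
      mul_le_mul_of_nonneg_left (by linarith [hu.2]) (by positivity)
    have h5 : lam / (2 * m) * y ^ (m - 1) * 2 = lam / m * y ^ (m - 1) := by field_simp
    have h6 : 0 ≤ (C₁ + C₃) * y ^ (m - 1) := by positivity
    have h7 : C₂ * y ^ (m - 1) = Lam * 2 ^ m * (2 * y ^ (m - 1)) + lam / m * y ^ (m - 1) := by
      rw [hC₂]; ring
    linarith
  · have h1 := le_rpow_add_one hB hp.le
    have h2 : 1 ≤ 8 ^ (m - 1) * y ^ (m - 1) := by
      rw [← Real.mul_rpow (by norm_num) hy.le]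
      exact Real.one_le_rpow (by linarith) (by linarith)
    have h3 : C₃ * y ^ (m - 1) = 2 * (2 * y ^ (m - 1) + 8 ^ (m - 1) * y ^ (m - 1)) := by
      rw [hC₃]; ring
    have h6 : 0 ≤ (C₁ + C₂) * y ^ (m - 1) := by positivity
    linarith

lemma LipschitzWith.exists_mul_of_bounded {X : Type*} [PseudoMetricSpace X] {f g : X → ℝ}
    {Kf Kg : NNReal} (hf : LipschitzWith Kf f) (hg : LipschitzWith Kg g) {Mf Mg : ℝ}
    (hfM : ∀ x, |f x| ≤ Mf) (hgM : ∀ x, |g x| ≤ Mg) :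
    ∃ K, LipschitzWith K fun x ↦ f x * g x := by
  refine ⟨(Mf * Kg + Mg * Kf).toNNReal, LipschitzWith.of_dist_le' fun x y ↦ ?_⟩
  have h1 := hf.dist_le_mul x y
  have h2 := hg.dist_le_mul x y
  rw [Real.dist_eq] at h1 h2 ⊢
  calc |f x * g x - f y * g y| = |f x * (g x - g y) + g y * (f x - f y)| := by congr 1; ring
    _ ≤ |f x| * |g x - g y| + |g y| * |f x - f y| := by
        simpa only [abs_mul] using abs_add_le (f x * (g x - g y)) (g y * (f x - f y))
    _ ≤ Mf * (Kg * dist x y) + Mg * (Kf * dist x y) :=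
        add_le_add (mul_le_mul (hfM x) h2 (abs_nonneg _) ((abs_nonneg _).trans (hfM x)))
          (mul_le_mul (hgM y) h1 (abs_nonneg _) ((abs_nonneg _).trans (hgM y)))
    _ = _ := by ring

/-- Minimality against the barrier `η - 1`, combined with the supersolution property of the
barrier. -/
lemma IsSubminimal.exists_integral_excess_nonpos {n : ℕ} (hn : 2 ≤ n) {p : ℝ} (hp : 1 < p)
    {W : ℝ → ℝ} (hW : ContinuousOn W (Icc (-1) 1)) {U : EuclideanSpace ℝ (Fin n) → ℝ}
    {K : NNReal} (hU : LipschitzWith K U) (hU1 : ∀ x, U x ∈ Icc (-1 : ℝ) 1) {ρ : ℝ}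
    (h : IsSubminimal p W U ρ) {η g F : EuclideanSpace ℝ (Fin n) → ℝ} {Kη Kg : NNReal}
    (hη : LipschitzWith Kη η) (hg : LipschitzWith Kg g) (hη2 : ∀ x, 0 < η x ∧ η x ≤ 2) {M : ℝ}
    (hgM : ∀ x, 0 ≤ g x ∧ g x ≤ M) (hηρ : ∀ x, ρ ≤ ‖x‖ → η x = 2)
    (hbar : ∀ x, η x < 2 → x ≠ 0 → DifferentiableAt ℝ η x ∧ DifferentiableAt ℝ g x ∧
      fderiv ℝ η x x = ‖fderiv ℝ η x‖ * ‖x‖ ∧ ‖fderiv ℝ η x‖ ^ (p - 1) = g x * ‖x‖ ∧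
      p * (n * g x + fderiv ℝ g x x) ≤ F x) :
    ∃ Q : EuclideanSpace ℝ (Fin n) → ℝ, IntegrableOn Q {x | η x < 1 + U x} ∧
      ∫ x in {x | η x < 1 + U x}, Q x ≤ 0 ∧ ∀ᵐ x, η x < 1 + U x →
        ‖fderiv ℝ U x‖ ^ p - ‖fderiv ℝ η x‖ ^ p
          - p * ‖fderiv ℝ η x‖ ^ (p - 1) * (‖fderiv ℝ U x‖ - ‖fderiv ℝ η x‖)
          + W (U x) - W (η x - 1) - F x * (1 + U x - η x) ≤ Q x := by
  have hp0 : 0 ≤ p := by linarith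
  obtain ⟨S, hSdef⟩ : ∃ S, S = {x | η x < 1 + U x} := ⟨_, rfl⟩
  have hmem (x) : x ∈ S ↔ η x < 1 + U x := by rw [hSdef]; rfl
  have hSo : IsOpen S := hSdef ▸ isOpen_lt hη.continuous (continuous_const.add hU.continuous)
  have hSρ : S ⊆ ball 0 ρ := fun x hx ↦ by
    rw [mem_ball_zero_iff]
    by_contra! hx2
    have := (hmem x).1 hx
    rw [hηρ x hx2] at this
    linarith [(hU1 x).2]
  have hSfin : volume S ≠ ⊤ := measure_ne_top_of_subset hSρ measure_ball_lt_top.ne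
  have hφL : LipschitzWith Kη fun x ↦ η x - 1 := by
    simpa using hη.sub (LipschitzWith.const (1 : ℝ))
  have hφ1 (x) : η x - 1 ∈ Icc (-1 : ℝ) 1 := ⟨by linarith [hη2 x], by linarith [hη2 x]⟩
  have hmin := h (fun x ↦ η x - 1) ⟨_, hφL⟩ hφ1 fun x hx ↦ by rw [hηρ x hx]; norm_num
  simp only [fderiv_sub_const, sub_lt_iff_lt_add'] at hmin
  rw [← hSdef] at hmin ⊢
  have iU := hU.integrableOn_norm_fderiv_rpow hp0 hSfin
  have iη := hη.integrableOn_norm_fderiv_rpow hp0 hSfin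
  have iWU := integrableOn_comp_of_continuousOn_compact isCompact_Icc hW hU.continuous hU1 hSfin
  have iWη := integrableOn_comp_of_continuousOn_compact isCompact_Icc hW hφL.continuous hφ1 hSfin
  -- the test function `f = g (U - (η - 1))₊`
  obtain ⟨f, hf⟩ : ∃ f : EuclideanSpace ℝ (Fin n) → ℝ,
    f = fun x ↦ g x * max (1 + U x - η x) 0 := ⟨_, rfl⟩
  have hw : LipschitzWith (0 + K + Kη) fun x ↦ max (1 + U x - η x) 0 :=
    (((LipschitzWith.const (1 : ℝ)).add hU).sub hη).max_const 0
  obtain ⟨Kf, hfL⟩ : ∃ Kf, LipschitzWith Kf f := hf ▸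
    hg.exists_mul_of_bounded hw (Mf := M) (Mg := 2)
      (fun x ↦ by rw [abs_of_nonneg (hgM x).1]; exact (hgM x).2)
      (fun x ↦ by
        rw [abs_of_nonneg (le_max_right _ _)]
        exact max_le (by linarith [hη2 x, (hU1 x).2]) zero_le_two)
  have hf0 (x) : 0 ≤ f x := by rw [hf]; exact mul_nonneg (hgM x).1 (le_max_right _ _)
  have hfS (x) (hx : x ∉ S) : f x = 0 := by
    rw [hmem, not_lt] at hx
    rw [hf]
    simp only [max_eq_right (sub_nonpos.2 hx), mul_zero]
  have hfS' (x) (hx : x ∉ S) : fderiv ℝ f x x = 0 := by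
    have : IsLocalMin f x := Eventually.of_forall fun y ↦ by rw [hfS x hx]; exact hf0 y
    rw [this.fderiv_eq_zero]; simp
  have hsupp : HasCompactSupport f := HasCompactSupport.intro (isCompact_closedBall 0 ρ)
    fun x hx ↦ hfS x fun hx' ↦ hx (ball_subset_closedBall (hSρ hx'))
  have hdiv := hfL.integral_fderiv_apply_self hsupp
  rw [← setIntegral_eq_integral_of_forall_compl_eq_zero hfS',
    ← setIntegral_eq_integral_of_forall_compl_eq_zero hfS] at hdiv
  have if1 : IntegrableOn f S :=
    (hfL.continuous.integrable_of_hasCompactSupport hsupp).integrableOn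
  have if2 : IntegrableOn (fun x ↦ fderiv ℝ f x x) S := by
    have hmeas : Measurable fun x ↦ fderiv ℝ f x x := by
      have : SecondCountableTopology (EuclideanSpace ℝ (Fin n) →L[ℝ] ℝ) :=
        have := FiniteDimensional.proper ℝ (EuclideanSpace ℝ (Fin n) →L[ℝ] ℝ)
        secondCountable_of_proper
      exact isBoundedBilinearMap_apply.continuous.measurable.comp
        ((measurable_fderiv ℝ f).prodMk measurable_id)
    refine Measure.integrableOn_of_bounded (M := Kf * ρ) hSfin hmeas.aestronglyMeasurable ?_
    filter_upwards [ae_restrict_mem hSo.measurableSet] with x hx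
    exact ((fderiv ℝ f x).le_opNorm x).trans <| mul_le_mul (norm_fderiv_le_of_lipschitz ℝ hfL)
      (mem_ball_zero_iff.1 (hSρ hx)).le (norm_nonneg _) Kf.2
  have i1 : IntegrableOn (fun x ↦ ‖fderiv ℝ U x‖ ^ p + W (U x)) S := iU.add iWU
  have i2 : IntegrableOn (fun x ↦ ‖fderiv ℝ η x‖ ^ p + W (η x - 1)) S := iη.add iWη
  have i3 : IntegrableOn (fun x ↦ p * (fderiv ℝ f x x + n * f x)) S :=
    (if2.add (if1.const_mul _)).const_mul p
  refine ⟨fun x ↦ ((‖fderiv ℝ U x‖ ^ p + W (U x)) - (‖fderiv ℝ η x‖ ^ p + W (η x - 1))) -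
    p * (fderiv ℝ f x x + n * f x), ?_, ?_, ?_⟩
  · exact (i1.sub i2).sub i3
  · have i4 : IntegrableOn (fun x ↦ (‖fderiv ℝ U x‖ ^ p + W (U x)) -
        (‖fderiv ℝ η x‖ ^ p + W (η x - 1))) S := i1.sub i2
    rw [integral_sub i4 i3, integral_sub i1 i2, integral_const_mul,
      integral_add if2 (if1.const_mul _), integral_const_mul, hdiv]
    linarith
  have : Nontrivial (Fin n) := Fin.nontrivial_iff_two_le.2 hn
  have h0 : ∀ᵐ x : EuclideanSpace ℝ (Fin n), x ≠ 0 := by simp [ae_iff]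
  filter_upwards [h0, hU.ae_differentiableAt] with x hx0 hUd hxS
  obtain ⟨hηd, hgd, hb1, hb2, hb3⟩ := hbar x (by linarith [(hU1 x).2]) hx0
  have hfx : f x = g x * (1 + U x - η x) := by
    rw [hf]
    simp only [max_eq_left (sub_pos.2 hxS).le]
  have hfd : fderiv ℝ f x x = g x * (fderiv ℝ U x x - fderiv ℝ η x x) +
      (1 + U x - η x) * fderiv ℝ g x x := by
    have hev : f =ᶠ[𝓝 x] fun y ↦ g y * (1 + U y - η y) := by
      filter_upwards [hSo.mem_nhds ((hmem x).2 hxS)] with y hy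
      rw [hf]
      simp only [max_eq_left (sub_pos.2 ((hmem y).1 hy)).le]
    have hd : HasFDerivAt (fun y ↦ g y * (1 + U y - η y)) _ x :=
      hgd.hasFDerivAt.mul ((hUd.hasFDerivAt.const_add 1).sub hηd.hasFDerivAt)
    rw [hev.fderiv_eq, hd.fderiv]
    simp
  have hle : g x * fderiv ℝ U x x ≤ g x * ‖x‖ * ‖fderiv ℝ U x‖ := by
    rw [mul_assoc, mul_comm ‖x‖]
    exact mul_le_mul_of_nonneg_left
      ((le_abs_self _).trans ((fderiv ℝ U x).le_opNorm x)) (hgM x).1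
  have hw0 : 0 ≤ 1 + U x - η x := (sub_pos.2 hxS).le
  have h3 := mul_le_mul_of_nonneg_right hb3 hw0
  have h4 := mul_le_mul_of_nonneg_left hle hp0
  rw [hfx, hfd, hb1, mul_assoc p, hb2]
  linarith

/-- Gradient bounds for the truncated difference of `1 + U` and `2 η`. -/
lemma norm_fderiv_truncated_sub_le {E : Type*} [NormedAddCommGroup E] [NormedSpace ℝ E]
    {U η ψ : E → ℝ} {x : E}
    (hψ : ψ = fun y ↦ max (min (1 + U y) (1 / 2) - max (2 * η y) (1 / 4)) 0)
    (hψd : DifferentiableAt ℝ ψ x) (hU : DifferentiableAt ℝ U x) (hη : DifferentiableAt ℝ η x) :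
    (ψ x = 0 → ‖fderiv ℝ ψ x‖ = 0) ∧ ‖fderiv ℝ ψ x‖ ≤ ‖fderiv ℝ U x‖ + 2 * ‖fderiv ℝ η x‖ ∧
      (-(1 / 2) < U x → ‖fderiv ℝ ψ x‖ ≤ 2 * ‖fderiv ℝ η x‖ ∧
        (η x < 1 / 8 → ‖fderiv ℝ ψ x‖ = 0)) := by
  have key (a b c d : ℝ) : |max (a - max (2 * b) (1 / 4)) 0 - max (c - max (2 * d) (1 / 4)) 0| ≤
      |a - c| + 2 * |b - d| := by
    calc _ ≤ |(a - max (2 * b) (1 / 4)) - (c - max (2 * d) (1 / 4))| :=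
          abs_max_sub_max_le_abs _ _ _
      _ = |(a - c) - (max (2 * b) (1 / 4) - max (2 * d) (1 / 4))| := by congr 1; ring
      _ ≤ |a - c| + |max (2 * b) (1 / 4) - max (2 * d) (1 / 4)| := abs_sub _ _
      _ ≤ |a - c| + |2 * b - 2 * d| := add_le_add le_rfl (abs_max_sub_max_le_abs _ _ _)
      _ = _ := by rw [← mul_sub, abs_mul, abs_two]
  refine ⟨fun h0 ↦ ?_, ?_, fun hx ↦ ?_⟩
  · have : IsLocalMin ψ x := Eventually.of_forall fun y ↦ by
      rw [h0, hψ]; exact le_max_right _ _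
    rw [this.fderiv_eq_zero, norm_zero]
  · refine norm_fderiv_le_add_of_eventually zero_le_two hψd hU hη (Eventually.of_forall fun y ↦ ?_)
    rw [hψ]
    have h1 := key (min (1 + U y) (1 / 2)) (η y) (min (1 + U x) (1 / 2)) (η x)
    have h2 := abs_min_sub_min_le_max (1 + U y) (1 / 2) (1 + U x) (1 / 2)
    rw [sub_self, abs_zero, max_eq_left (abs_nonneg _), add_sub_add_left_eq_sub] at h2
    simp only
    linarith
  have hev : ∀ᶠ y in 𝓝 x, min (1 + U y) (1 / 2) = 1 / 2 := by
    filter_upwards [hU.continuousAt.eventually (lt_mem_nhds hx)] with y hy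
    exact min_eq_right (by linarith)
  have hmx := hev.self_of_nhds
  constructor
  · have := norm_fderiv_le_add_of_eventually zero_le_two hψd
      (differentiableAt_const (0 : ℝ)) hη (by
        filter_upwards [hev] with y hy
        have := key (1 / 2) (η y) (1 / 2) (η x)
        rw [hψ]
        simpa only [hy, hmx, sub_self] using this)
    simpa using this
  · intro hη8
    have : ψ =ᶠ[𝓝 x] fun _ ↦ max (1 / 2 - 1 / 4) 0 := by
      filter_upwards [hev, hη.continuousAt.eventually (gt_mem_nhds hη8)] with y hy hy2
      rw [hψ]
      simp only [hy]
      rw [max_eq_right (a := 2 * η y) (by linarith)]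
    rw [this.fderiv_eq]
    simp

lemma exists_volume_pow_le {n : ℕ} (hn : 2 ≤ n) {p m lam Lam : ℝ} (hp : 1 < p) (hpm : p < m)
    (hlam : 0 < lam) (hLam : 0 < Lam) : ∃ C > 0, ∃ k : ℕ, 1 ≤ k ∧
      ∀ W : ℝ → ℝ, IsAdmissiblePotential m lam Lam W →
      ∀ U : EuclideanSpace ℝ (Fin n) → ℝ, (∃ K, LipschitzWith K U) →
      (∀ x, U x ∈ Icc (-1 : ℝ) 1) → ∀ ρ > 0, IsSubminimal p W U ρ →
      volume.real ({x | -(1 / 2) < U x} ∩ ball 0 (ρ - k)) ^ (n - 1) ≤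
        (C * ∫ x in {x | -(1 / 2) < U x} ∩ ball 0 ρ,
          (max (ρ - ‖x‖) 1) ^ (-(p / (m - p) * (m - 1)))) ^ n := by
  have hm : 1 < m := hp.trans hpm
  have hq : 0 < p / (m - p) := div_pos (by linarith) (by linarith)
  obtain ⟨C₀, hC₀, hexc⟩ := exists_excess_bounds hp hm hlam hLam
  obtain ⟨A, hA, hbarrier⟩ := exists_barrier n hp hpm (κ := lam / (2 * m)) (by positivity)
  obtain ⟨k, hk1, hk⟩ : ∃ k : ℕ, 1 ≤ k ∧ A * (k : ℝ) ^ (-(p / (m - p))) ≤ 1 / 8 := by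
    have h1 : Tendsto (fun k : ℕ ↦ A * (k : ℝ) ^ (-(p / (m - p)))) atTop (𝓝 (A * 0)) :=
      ((tendsto_rpow_neg_atTop hq).comp tendsto_natCast_atTop_atTop).const_mul A
    rw [mul_zero] at h1
    exact ((eventually_ge_atTop 1).and (h1.eventually_le_const (by norm_num))).exists
  obtain ⟨B, hB⟩ : ∃ B : ℝ, B = max (2 ^ (m - 1)) (A ^ (m - 1)) := ⟨_, rfl⟩
  have hB0 : 0 < B := hB ▸ lt_max_of_lt_left (by positivity)
  refine ⟨4 * (n * ((C₀ * C₀ + C₀) * B)), by positivity, k, hk1,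
    fun W hW U ⟨K, hU⟩ hU1 ρ hρ hsub ↦ ?_⟩
  obtain ⟨η, g, ⟨Kη, hη⟩, ⟨Kg, hg⟩, hη2, ⟨M, hgM⟩, hηρ, hηA, hbar⟩ := hbarrier ρ hρ
  obtain ⟨Q, hQi, hQ0, hQ⟩ := hsub.exists_integral_excess_nonpos hn hp
    (hW.continuousOn (by linarith) hlam) hU hU1 hη hg hη2 hgM hηρ
    (F := fun x ↦ lam / (2 * m) * η x ^ (m - 1))
    fun x h1 h2 ↦ by
      obtain ⟨a, b, c, d, -, e⟩ := hbar x h1 h2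
      exact ⟨a, b, c, d, e⟩
  obtain ⟨S, hSdef⟩ : ∃ S, S = {x | η x < 1 + U x} := ⟨_, rfl⟩
  obtain ⟨Z, hZdef⟩ : ∃ Z, Z = {x | -(1 / 2) < U x} := ⟨_, rfl⟩
  have hmem (x) : x ∈ S ↔ η x < 1 + U x := by rw [hSdef]; rfl
  have hmemZ (x) : x ∈ Z ↔ -(1 / 2) < U x := by rw [hZdef]; rfl
  have hSm : MeasurableSet S :=
    hSdef ▸ (isOpen_lt hη.continuous (continuous_const.add hU.continuous)).measurableSet
  have hZm : MeasurableSet Z :=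
    hZdef ▸ (isOpen_lt continuous_const hU.continuous).measurableSet
  have hSρ : S ⊆ ball 0 ρ := fun x hx ↦ by
    rw [mem_ball_zero_iff]
    by_contra! hx2
    have := (hmem x).1 hx
    rw [hηρ x hx2] at this
    linarith [(hU1 x).2]
  rw [← hSdef] at hQi hQ0
  rw [← hZdef]
  obtain ⟨ψ, hψ⟩ : ∃ ψ : EuclideanSpace ℝ (Fin n) → ℝ,
    ψ = fun y ↦ max (min (1 + U y) (1 / 2) - max (2 * η y) (1 / 4)) 0 := ⟨_, rfl⟩
  have hψL : LipschitzWith (0 + K + 2 * Kη) ψ := by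
    have h2 : LipschitzWith (2 * Kη) fun y ↦ 2 * η y := by
      refine LipschitzWith.of_dist_le_mul fun x y ↦ ?_
      have := hη.dist_le_mul x y
      rw [Real.dist_eq] at this ⊢
      rw [← mul_sub, abs_mul, abs_two]
      push_cast
      linarith
    rw [hψ]
    exact ((((LipschitzWith.const (1 : ℝ)).add hU).min_const _).sub (h2.max_const _)).max_const 0
  have hψ0 (x) : 0 ≤ ψ x := by rw [hψ]; exact le_max_right _ _
  have hψpos (x) (hx : ψ x ≠ 0) : 2 * η x ≤ 1 + U x ∧ 1 / 4 ≤ 1 + U x := by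
    have h1 : 0 < ψ x := lt_of_le_of_ne (hψ0 x) hx.symm
    rw [hψ] at h1
    simp only [lt_max_iff, lt_self_iff_false, or_false, sub_pos] at h1
    have h2 := h1.trans_le (min_le_left _ _)
    exact ⟨((le_max_left _ _).trans_lt h2).le, ((le_max_right _ _).trans_lt h2).le⟩
  have hψS (x) (hx : x ∉ S) : ψ x = 0 := by
    by_contra h
    have h1 := hψpos x h
    exact hx ((hmem x).2 (by linarith [hη2 x]))
  have hsupp : HasCompactSupport ψ := HasCompactSupport.intro (isCompact_closedBall 0 ρ)
    fun x hx ↦ hψS x fun hx' ↦ hx (ball_subset_closedBall (hSρ hx'))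
  obtain ⟨w, hw⟩ : ∃ w : EuclideanSpace ℝ (Fin n) → ℝ,
    w = fun x ↦ (max (ρ - ‖x‖) 1) ^ (-(p / (m - p) * (m - 1))) := ⟨_, rfl⟩
  have hwc : Continuous w := by
    rw [hw]
    refine Continuous.rpow_const (by fun_prop) fun x ↦ Or.inl ?_
    exact (zero_lt_one.trans_le (le_max_right _ _)).ne'
  have hw0 (x) : 0 ≤ w x := by
    rw [hw]
    exact Real.rpow_nonneg (zero_le_one.trans (le_max_right _ _)) _
  have hηw (x) (hx : x ∈ ball (0 : EuclideanSpace ℝ (Fin n)) ρ) : η x ^ (m - 1) ≤ B * w x := by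
    rw [mem_ball_zero_iff] at hx
    rw [hw]
    simp only
    rcases le_total (ρ - ‖x‖) 1 with h1 | h1
    · rw [max_eq_right h1, Real.one_rpow, mul_one, hB]
      exact (Real.rpow_le_rpow (hη2 x).1.le (hη2 x).2 (by linarith)).trans (le_max_left _ _)
    · have h2 : 0 ≤ ρ - ‖x‖ := by linarith
      rw [max_eq_left h1]
      calc η x ^ (m - 1) ≤ (A * (ρ - ‖x‖) ^ (-(p / (m - p)))) ^ (m - 1) :=
            Real.rpow_le_rpow (hη2 x).1.le (hηA x hx) (by linarith)
        _ = A ^ (m - 1) * (ρ - ‖x‖) ^ (-(p / (m - p) * (m - 1))) := by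
            rw [Real.mul_rpow hA.le (Real.rpow_nonneg h2 _), ← Real.rpow_mul h2, neg_mul]
        _ ≤ _ := by rw [hB]; gcongr; exact le_max_right _ _
  have hwi : IntegrableOn w (ball 0 ρ) :=
    (hwc.continuousOn.integrableOn_compact (isCompact_closedBall 0 ρ)).mono_set
      ball_subset_closedBall
  have hpt : ∀ᵐ x, x ∈ S → ‖fderiv ℝ ψ x‖ ≤
      C₀ * Q x + (C₀ * C₀ + C₀) * B * Z.indicator w x := by
    have : Nontrivial (Fin n) := Fin.nontrivial_iff_two_le.2 hn
    have h0 : ∀ᵐ x : EuclideanSpace ℝ (Fin n), x ≠ 0 := by simp [ae_iff]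
    filter_upwards [hQ, h0, hU.ae_differentiableAt, hψL.ae_differentiableAt]
      with x hQx hx0 hUd hψd hxS
    have hxS' := (hmem x).1 hxS
    have hη1 : η x < 2 := by linarith [(hU1 x).2]
    obtain ⟨hηd, -, -, -, hpow, -⟩ := hbar x hη1 hx0
    obtain ⟨e1, e2, e3⟩ := hexc W hW _ _ _ _ _ (norm_nonneg (fderiv ℝ U x))
      (norm_nonneg (fderiv ℝ η x)) (hη2 x).1 (hη2 x).2 (hU1 x) hxS' hpow (hQx hxS')
    obtain ⟨g1, g2, g3⟩ := norm_fderiv_truncated_sub_le hψ hψd hUd hηd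
    by_cases hxZ : x ∈ Z
    · rw [indicator_of_mem hxZ]
      have hw' := hηw x (hSρ hxS)
      have hZx := (hmemZ x).1 hxZ
      have g4 : ‖fderiv ℝ ψ x‖ ≤ C₀ * η x ^ (m - 1) := by
        rcases lt_or_ge (η x) (1 / 8) with h8 | h8
        · rw [(g3 hZx).2 h8]
          have := (hη2 x).1
          positivity
        · exact (g3 hZx).1.trans (e3 h8)
      have h5 := mul_le_mul_of_nonneg_left e2 hC₀.le
      have h6 := mul_le_mul_of_nonneg_left hw' (by positivity : 0 ≤ C₀ * C₀ + C₀)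
      linarith
    · rw [indicator_of_notMem hxZ, mul_zero, add_zero]
      have hUx : U x ≤ -(1 / 2) := not_lt.1 fun h ↦ hxZ ((hmemZ x).2 h)
      obtain ⟨f1, f2⟩ := e1 hUx
      by_cases hψx : ψ x = 0
      · rw [g1 hψx]; positivity
      · exact g2.trans (f2 (hψpos x hψx).1 (hψpos x hψx).2)
  have hwiS : IntegrableOn (Z.indicator w) S := (hwi.mono_set hSρ).indicator hZm
  have hint : ∫ x, ‖fderiv ℝ ψ x‖ ≤ (C₀ * C₀ + C₀) * B * ∫ x in Z ∩ ball 0 ρ, w x := by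
    have hi : IntegrableOn (fun x ↦ C₀ * Q x + (C₀ * C₀ + C₀) * B * Z.indicator w x) S :=
      (hQi.const_mul _).add (hwiS.const_mul _)
    refine (integral_norm_fderiv_le_setIntegral hψ0 hSm hψS hi hpt).trans ?_
    rw [integral_add (hQi.const_mul _) (hwiS.const_mul _), integral_const_mul,
      integral_const_mul, setIntegral_indicator hZm]
    have h1 : ∫ x in S ∩ Z, w x ≤ ∫ x in Z ∩ ball 0 ρ, w x :=
      setIntegral_mono_set (hwi.mono_set inter_subset_right) (ae_of_all _ hw0)
        (LE.le.eventuallyLE fun x hx ↦ ⟨hx.2, hSρ hx.1⟩)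
    have h2 := mul_nonpos_of_nonneg_of_nonpos hC₀.le hQ0
    have h3 := mul_le_mul_of_nonneg_left h1 (by positivity : 0 ≤ (C₀ * C₀ + C₀) * B)
    linarith
  have hsob := hψL.pow_mul_volume_pow_le hn hsupp (c := 1 / 4) (by norm_num)
    (S := Z ∩ ball 0 (ρ - k)) fun x hx ↦ by
      have hx1 := mem_ball_zero_iff.1 hx.2
      have hk0 : (0 : ℝ) < k := by exact_mod_cast hk1
      have h8 : η x ≤ 1 / 8 := by
        refine (hηA x (by linarith)).trans (le_trans ?_ hk)
        exact mul_le_mul_of_nonneg_left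
          (Real.rpow_le_rpow_of_nonpos hk0 (by linarith) (by linarith)) hA.le
      have := (hmemZ x).1 hx.1
      rw [hψ]
      simp only
      rw [min_eq_right (by linarith), max_eq_right (a := 2 * η x) (by linarith)]
      norm_num
  calc volume.real (Z ∩ ball 0 (ρ - k)) ^ (n - 1)
      = 4 ^ n * ((1 / 4) ^ n * volume.real (Z ∩ ball 0 (ρ - k)) ^ (n - 1)) := by
        rw [← mul_assoc, ← mul_pow]; norm_num
    _ ≤ 4 ^ n * (n * ((C₀ * C₀ + C₀) * B * ∫ x in Z ∩ ball 0 ρ, w x)) ^ n := by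
        refine mul_le_mul_of_nonneg_left (hsob.trans ?_) (by positivity)
        refine pow_le_pow_left₀ (by positivity) ?_ n
        exact mul_le_mul_of_nonneg_left hint (by positivity)
    _ = _ := by rw [← mul_pow, hw]; congr 1; ring

lemma exists_sum_rpow_neg_le {α : ℝ} (hα : 1 < α) : ∃ D > 0, ∀ (N : ℕ) (t : ℝ), 0 ≤ t →
    ∑ j ∈ Finset.range (N + 1), (if t < j then (max ((j : ℝ) - t) 1) ^ (-α) else 0) ≤ D := by
  have ha : Summable fun i : ℕ ↦ (max (i : ℝ) 1) ^ (-α) := by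
    refine (Real.summable_nat_rpow.2 (by linarith : -α < -1)).congr_atTop ?_
    filter_upwards [eventually_ge_atTop 1] with i hi
    rw [max_eq_left (by exact_mod_cast hi)]
  have ha0 (i : ℕ) : 0 ≤ (max (i : ℝ) 1) ^ (-α) :=
    Real.rpow_nonneg (zero_le_one.trans (le_max_right _ _)) _
  refine ⟨∑' i : ℕ, (max (i : ℝ) 1) ^ (-α), ha.tsum_pos ha0 0 (by simp), fun N t ht ↦ ?_⟩
  rw [← Finset.sum_filter]
  have hlt (j : ℕ) (hj : t < j) : ⌊t⌋₊ + 1 ≤ j := (Nat.floor_lt ht).2 hj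
  calc _ ≤ ∑ j ∈ Finset.range (N + 1) with t < ((j : ℕ) : ℝ),
        (max ((j - (⌊t⌋₊ + 1) : ℕ) : ℝ) 1) ^ (-α) := by
        refine Finset.sum_le_sum fun j hj ↦ ?_
        have hj' := (Finset.mem_filter.1 hj).2
        refine Real.rpow_le_rpow_of_nonpos (zero_lt_one.trans_le (le_max_right _ _))
          (max_le_max ?_ le_rfl) (by linarith)
        rw [Nat.cast_sub (hlt j hj')]
        push_cast
        linarith [Nat.lt_floor_add_one t]
    _ = ∑ i ∈ ({j ∈ Finset.range (N + 1) | t < ((j : ℕ) : ℝ)}).image (· - (⌊t⌋₊ + 1)),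
        (max (i : ℝ) 1) ^ (-α) := by
        rw [Finset.sum_image]
        intro i hi j hj hij
        have h1 := hlt i (Finset.mem_filter.1 hi).2
        have h2 := hlt j (Finset.mem_filter.1 hj).2
        simp only at hij
        omega
    _ ≤ _ := ha.sum_le_tsum _ fun i _ ↦ ha0 i

lemma exists_sum_setIntegral_le {n : ℕ} {α : ℝ} (hα : 1 < α) : ∃ D > 0,
    ∀ Z : Set (EuclideanSpace ℝ (Fin n)), MeasurableSet Z → ∀ N : ℕ,
      ∑ j ∈ Finset.range (N + 1), ∫ x in Z ∩ ball 0 j, (max ((j : ℝ) - ‖x‖) 1) ^ (-α) ≤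
        D * volume.real (Z ∩ ball 0 N) := by
  obtain ⟨D, hD, h⟩ := exists_sum_rpow_neg_le hα
  refine ⟨D, hD, fun Z hZ N ↦ ?_⟩
  have hfin : volume (Z ∩ ball 0 N) ≠ ⊤ :=
    measure_ne_top_of_subset inter_subset_right measure_ball_lt_top.ne
  have hi (j : ℕ) : IntegrableOn
      (fun x : EuclideanSpace ℝ (Fin n) ↦ (max ((j : ℝ) - ‖x‖) 1) ^ (-α)) (Z ∩ ball 0 N) := by
    have hc : Continuous fun x : EuclideanSpace ℝ (Fin n) ↦ (max ((j : ℝ) - ‖x‖) 1) ^ (-α) :=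
      Continuous.rpow_const (by fun_prop) fun x ↦
        Or.inl (zero_lt_one.trans_le (le_max_right _ _)).ne'
    exact (hc.continuousOn.integrableOn_compact (isCompact_closedBall 0 (N : ℝ))).mono_set
      (inter_subset_right.trans ball_subset_closedBall)
  have hi' (j : ℕ) := (hi j).indicator (measurableSet_ball (x := 0) (ε := (j : ℝ)))
  calc _ = ∑ j ∈ Finset.range (N + 1), ∫ x in Z ∩ ball 0 N,
        (ball 0 (j : ℝ)).indicator (fun x ↦ (max ((j : ℝ) - ‖x‖) 1) ^ (-α)) x := by
        refine Finset.sum_congr rfl fun j hj ↦ ?_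
        rw [setIntegral_indicator measurableSet_ball, inter_assoc,
          inter_eq_self_of_subset_right (ball_subset_ball _)]
        exact_mod_cast Finset.mem_range_succ_iff.1 hj
    _ = ∫ x in Z ∩ ball 0 N, ∑ j ∈ Finset.range (N + 1),
        (ball 0 (j : ℝ)).indicator (fun x ↦ (max ((j : ℝ) - ‖x‖) 1) ^ (-α)) x :=
        (integral_finsetSum _ fun j _ ↦ hi' j).symm
    _ ≤ ∫ x in Z ∩ ball 0 N, D := by
        refine setIntegral_mono (integrable_finsetSum _ fun j _ ↦ hi' j)
          (integrableOn_const hfin) fun x ↦ ?_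
        refine (Finset.sum_le_sum fun j _ ↦ le_of_eq ?_).trans (h N ‖x‖ (norm_nonneg x))
        by_cases hx : ‖x‖ < j <;> simp [indicator, hx]
    _ = _ := by rw [setIntegral_const, smul_eq_mul, mul_comm]

lemma exists_mul_pow_le_of_recursion {n : ℕ} (hn : n ≠ 0) {C D c : ℝ} (hC : 0 < C) (hD : 0 < D)
    (hc : 0 < c) {k : ℕ} (hk : 1 ≤ k) : ∃ e > 0, ∀ (r : ℕ) (V I : ℕ → ℝ), Monotone V →
      (∀ j, 0 ≤ I j) → c ≤ V 1 → (∀ j, k < j → j ≤ r → V (j - k) ^ (n - 1) ≤ (C * I j) ^ n) →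
      (∀ N, ∑ j ∈ Finset.range (N + 1), I j ≤ D * V N) →
      ∀ N, 1 ≤ N → N ≤ r → (e * N) ^ n ≤ V N := by
  obtain ⟨l, rfl⟩ : ∃ l, n = l + 1 := ⟨n - 1, by omega⟩
  simp only [Nat.add_sub_cancel]
  have hk0 : (0 : ℝ) < k := by exact_mod_cast hk
  obtain ⟨e, he⟩ : ∃ e : ℝ,
      e = min (min (1 / (4 * (k : ℝ))) (c / (4 * (k : ℝ)))) (1 / (2 * 4 ^ l * (C * D))) := ⟨_, rfl⟩
  have he0 : 0 < e := he ▸ by positivity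
  have he1 : e * (4 * k) ≤ 1 := by
    rw [← le_div_iff₀ (by positivity), he]
    exact (min_le_left _ _).trans (min_le_left _ _)
  have he2 : e * (4 * k) ≤ c := by
    rw [← le_div_iff₀ (by positivity), he]
    exact (min_le_left _ _).trans (min_le_right _ _)
  have he3 : e * (2 * 4 ^ l * (C * D)) ≤ 1 := by
    rw [← le_div_iff₀ (by positivity), he]
    exact min_le_right _ _
  refine ⟨e, he0, fun r V I hV hI h1 hrec hsum N ↦ ?_⟩
  induction N using Nat.strong_induction_on with
  | _ N ih =>
  intro hN1 hNr
  have hN0 : (0 : ℝ) < N := by exact_mod_cast hN1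
  rcases le_or_gt N (4 * k) with hN | hN
  · have hN' : (N : ℝ) ≤ 4 * k := by exact_mod_cast hN
    calc (e * N) ^ (l + 1) ≤ (e * (4 * k)) ^ (l + 1) := by gcongr
      _ ≤ e * (4 * k) := pow_le_of_le_one (by positivity) he1 (by omega)
      _ ≤ V 1 := he2.trans h1
      _ ≤ V N := hV hN1
  have hN' : (4 * k : ℝ) < N := by exact_mod_cast hN
  have hIj (j) (hj : j ∈ Finset.Icc (N - N / 2) N) : (e * (N / 4)) ^ l ≤ C * I j := by
    obtain ⟨hj1, hj2⟩ := Finset.mem_Icc.1 hj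
    have hkj : k < j := by omega
    have hj3 : (N : ℝ) ≤ 2 * j := by exact_mod_cast (by omega : N ≤ 2 * j)
    have h2 : (N : ℝ) / 4 ≤ (j - k : ℕ) := by
      rw [Nat.cast_sub hkj.le]; linarith
    have h3 := ih (j - k) (by omega) (by omega) (by omega)
    refine le_of_pow_le_pow_left₀ (n := l + 1) (by omega) (mul_nonneg hC.le (hI j)) ?_
    calc ((e * (N / 4)) ^ l) ^ (l + 1) = ((e * (N / 4)) ^ (l + 1)) ^ l := by
          rw [← pow_mul, ← pow_mul, mul_comm l]
      _ ≤ ((e * (j - k : ℕ)) ^ (l + 1)) ^ l := by gcongr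
      _ ≤ V (j - k) ^ l := by gcongr
      _ ≤ _ := hrec j hkj (hj2.trans hNr)
  have hs : N / 2 * (e * (N / 4)) ^ l ≤ C * D * V N := by
    calc N / 2 * (e * (N / 4)) ^ l
        ≤ ((Finset.Icc (N - N / 2) N).card : ℝ) * (e * (N / 4)) ^ l := by
          refine mul_le_mul_of_nonneg_right ?_ (by positivity)
          rw [Nat.card_Icc, div_le_iff₀ two_pos]
          exact_mod_cast (by omega : N ≤ (N + 1 - (N - N / 2)) * 2)
      _ ≤ ∑ j ∈ Finset.Icc (N - N / 2) N, C * I j := by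
          rw [← nsmul_eq_mul]
          exact Finset.card_nsmul_le_sum _ _ _ hIj
      _ ≤ ∑ j ∈ Finset.range (N + 1), C * I j :=
          Finset.sum_le_sum_of_subset_of_nonneg (fun j hj ↦
            Finset.mem_range_succ_iff.2 (Finset.mem_Icc.1 hj).2)
            fun j _ _ ↦ mul_nonneg hC.le (hI j)
      _ ≤ _ := by
          rw [← Finset.mul_sum, mul_assoc]
          exact mul_le_mul_of_nonneg_left (hsum N) hC.le
  refine le_of_mul_le_mul_left (hs.trans' ?_) (mul_pos hC hD)
  have h4 : N / 2 * (e * (N / 4)) ^ l * (e * (2 * 4 ^ l * (C * D))) = C * D * (e * N) ^ (l + 1) := by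
    rw [pow_succ (e * N), mul_pow, mul_pow, div_pow]
    field_simp
  rw [← h4]
  exact mul_le_of_le_one_right (by positivity) he3

/-- Growth of the superlevel set `{U > -1/2}` in balls. -/
lemma exists_mul_pow_le_volume {n : ℕ} (hn : 2 ≤ n) {p m lam Lam : ℝ} (hp : 1 < p) (hpm : p < m)
    (hlam : 0 < lam) (hLam : 0 < Lam) : ∃ e > 0,
      ∀ W : ℝ → ℝ, IsAdmissiblePotential m lam Lam W →
      ∀ U : EuclideanSpace ℝ (Fin n) → ℝ, (∃ K, LipschitzWith K U) →
      (∀ x, U x ∈ Icc (-1 : ℝ) 1) → U 0 = 0 → ∀ N : ℕ, 1 ≤ N → IsSubminimal p W U N →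
      (e * N) ^ n ≤ volume.real ({x | -(1 / 2) < U x} ∩ ball 0 (N : ℝ)) := by
  have hm : 1 < m := hp.trans hpm
  obtain ⟨C, hC, k, hk, hrec⟩ := exists_volume_pow_le hn hp hpm hlam hLam
  have hα : 1 < p / (m - p) * (m - 1) := by
    rw [div_mul_eq_mul_div, one_lt_div (by linarith)]
    nlinarith
  obtain ⟨D, hD, hsum⟩ := exists_sum_setIntegral_le (n := n) hα
  obtain ⟨c, hc, hvol⟩ := exists_le_volume_unit_ball hn hp.le hLam.le
  obtain ⟨e, he, hmain⟩ := exists_mul_pow_le_of_recursion (n := n) (by omega) hC hD hc hk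
  refine ⟨e, he, fun W hW U hU hU1 hU0 N hN1 hsub ↦ ?_⟩
  have hZm : MeasurableSet {x | -(1 / 2) < U x} :=
    (isOpen_lt continuous_const hU.choose_spec.continuous).measurableSet
  refine hmain N (fun j ↦ volume.real ({x | -(1 / 2) < U x} ∩ ball 0 (j : ℝ))) _
    (fun i j hij ↦ ?_) (fun j ↦ ?_) ?_ (fun j hkj hjN ↦ ?_) (fun N ↦ hsum _ hZm N) N hN1 le_rfl
  · refine measureReal_mono (inter_subset_inter_right _ (ball_subset_ball ?_))
      (measure_ne_top_of_subset inter_subset_right measure_ball_lt_top.ne)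
    exact_mod_cast hij
  · exact integral_nonneg fun x ↦ Real.rpow_nonneg (zero_le_one.trans (le_max_right _ _)) _
  · simpa using hvol W (hW.continuousOn (by linarith) hlam)
      (fun τ hτ ↦ ⟨hW.nonneg (by linarith) hlam hτ, hW.le_const (by linarith) hLam hτ⟩) U hU hU1 hU0
      (hsub.mono (by exact_mod_cast hN1))
  · have := hrec W hW U hU hU1 j (by exact_mod_cast (by omega : 0 < j))
      (hsub.mono (by exact_mod_cast hjN))
    rwa [← Nat.cast_sub hkj.le] at this

/-- The intermediate level set of a minimizer has at most surface growth. -/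
lemma exists_volume_intermediate_le (n : ℕ) {p m lam Lam : ℝ} (hp : 0 < p) (hm : 0 < m)
    (hlam : 0 < lam) (hLam : 0 < Lam) : ∃ C > 0,
      ∀ W : ℝ → ℝ, IsAdmissiblePotential m lam Lam W →
      ∀ U : EuclideanSpace ℝ (Fin n) → ℝ, (∃ K, LipschitzWith K U) →
      (∀ x, U x ∈ Icc (-1 : ℝ) 1) → ∀ r > 0, IsSubminimal p W U (r + 1) →
      volume.real ({x | -(1 / 2) < U x ∧ U x < 0} ∩ ball 0 r) ≤ C * (r + 1) ^ (n - 1) := by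
  obtain ⟨ω, hω⟩ : ∃ ω : ℝ, ω = volume.real (ball (0 : EuclideanSpace ℝ (Fin n)) 1) := ⟨_, rfl⟩
  have hω0 : 0 ≤ ω := hω ▸ measureReal_nonneg
  obtain ⟨c, hc⟩ : ∃ c : ℝ, c = lam * (3 / 4) ^ m := ⟨_, rfl⟩
  have hc0 : 0 < c := hc ▸ by positivity
  refine ⟨(2 ^ p + Lam) * (ω * n) / c + 1, by positivity, fun W hW U ⟨K, hU⟩ hU1 r hr hsub ↦ ?_⟩
  obtain ⟨φ, hφdef⟩ : ∃ φ : EuclideanSpace ℝ (Fin n) → ℝ,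
      φ = fun x ↦ min (max (-1 + 2 * (‖x‖ - r)) (-1)) 1 := ⟨_, rfl⟩
  have hφ : LipschitzWith 2 φ := by
    have h1 : LipschitzWith 2 fun x : EuclideanSpace ℝ (Fin n) ↦ -1 + 2 * (‖x‖ - r) :=
      LipschitzWith.of_dist_le_mul fun x y ↦ by
        rw [Real.dist_eq, dist_eq_norm,
          show -1 + 2 * (‖x‖ - r) - (-1 + 2 * (‖y‖ - r)) = 2 * (‖x‖ - ‖y‖) by ring, abs_mul,
          abs_two]
        exact mul_le_mul_of_nonneg_left (abs_norm_sub_norm_le x y) zero_le_two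
    rw [hφdef]
    exact (h1.max_const _).min_const 1
  have hφ1 (x) : φ x ∈ Icc (-1 : ℝ) 1 := by
    rw [hφdef]
    exact ⟨le_min (le_max_right _ _) (by norm_num), min_le_right _ _⟩
  have hφr (x) (hx : r + 1 ≤ ‖x‖) : φ x = 1 := by
    rw [hφdef]
    exact min_eq_right (le_max_of_le_left (by linarith))
  have hφin (x) (hx : x ∈ ball (0 : EuclideanSpace ℝ (Fin n)) r) : φ x = -1 := by
    rw [mem_ball_zero_iff] at hx
    rw [hφdef]
    simp only
    rw [max_eq_right (by linarith), min_eq_left (by norm_num)]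
  have hS : {x | φ x < U x} ⊆ ball 0 (r + 1) := fun x hx ↦ by
    rw [mem_ball_zero_iff]
    by_contra! hx2
    exact ((hU1 x).2.trans_eq (hφr x hx2).symm).not_gt hx
  have hSm : MeasurableSet {x | φ x < U x} :=
    (isOpen_lt hφ.continuous hU.continuous).measurableSet
  have hSfin : volume {x | φ x < U x} ≠ ⊤ := measure_ne_top_of_subset hS measure_ball_lt_top.ne
  have hWc := hW.continuousOn hm hlam
  have iU := hU.integrableOn_norm_fderiv_rpow hp.le hSfin
  have iφ := hφ.integrableOn_norm_fderiv_rpow hp.le hSfin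
  have iWU := integrableOn_comp_of_continuousOn_compact isCompact_Icc hWc hU.continuous hU1 hSfin
  have iWφ := integrableOn_comp_of_continuousOn_compact isCompact_Icc hWc hφ.continuous hφ1 hSfin
  have hmin := hsub φ ⟨_, hφ⟩ hφ1 hφr
  obtain ⟨T, hT⟩ : ∃ T, T = {x | -(1 / 2) < U x ∧ U x < 0} ∩ ball 0 r := ⟨_, rfl⟩
  have hTS : T ⊆ {x | φ x < U x} := fun x hx ↦ by
    rw [hT] at hx
    have h1 : -(1 / 2) < U x := hx.1.1
    rw [Set.mem_ofPred_eq, hφin x hx.2]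
    linarith
  have hTm : MeasurableSet T := by
    rw [hT]
    exact (((isOpen_lt continuous_const hU.continuous).inter
      (isOpen_lt hU.continuous continuous_const)).inter isOpen_ball).measurableSet
  have hlow : c * volume.real T ≤ ∫ x in {x | φ x < U x}, (‖fderiv ℝ U x‖ ^ p + W (U x)) := by
    calc c * volume.real T = ∫ x in T, c := by rw [setIntegral_const, smul_eq_mul, mul_comm]
      _ ≤ ∫ x in T, (‖fderiv ℝ U x‖ ^ p + W (U x)) := by
          refine setIntegral_mono_on (integrableOn_const (measure_ne_top_of_subset hTS hSfin))
            ((iU.add iWU).mono_set hTS) hTm fun x hx ↦ ?_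
          rw [hT] at hx
          have h1 : -(1 / 2) < U x := hx.1.1
          have h2 : U x < 0 := hx.1.2
          have h3 : (3 / 4 : ℝ) ^ m ≤ (1 - U x ^ 2) ^ m :=
            Real.rpow_le_rpow (by norm_num) (by nlinarith) hm.le
          have h4 := hW.mul_rpow_le hm (hU1 x)
          have h5 := mul_le_mul_of_nonneg_left h3 hlam.le
          have h6 : 0 ≤ ‖fderiv ℝ U x‖ ^ p := by positivity
          linarith
      _ ≤ _ := setIntegral_mono_set (iU.add iWU) (ae_of_all _ fun x ↦
          add_nonneg (by positivity) (hW.nonneg hm hlam (hU1 x))) hTS.eventuallyLE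
  have hup : ∫ x in {x | φ x < U x}, (‖fderiv ℝ φ x‖ ^ p + W (φ x)) ≤
      (2 ^ p + Lam) * (ω * n * (r + 1) ^ (n - 1)) := by
    have hball (s : ℝ) (hs : 0 < s) :
        volume.real (ball (0 : EuclideanSpace ℝ (Fin n)) s) = s ^ n * ω := by
      rw [measureReal_def, Measure.addHaar_ball_of_pos _ _ hs, finrank_euclideanSpace_fin,
        ENNReal.toReal_mul, ENNReal.toReal_ofReal (by positivity), hω, measureReal_def]
    have hsh : volume.real (ball (0 : EuclideanSpace ℝ (Fin n)) (r + 1) \ ball 0 r) ≤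
        ω * n * (r + 1) ^ (n - 1) := by
      have h2 := (le_abs_self _).trans (abs_pow_sub_pow_le (r + 1) r n)
      rw [add_sub_cancel_left, abs_one, one_mul, abs_of_pos hr,
        abs_of_nonneg (by linarith : 0 ≤ r + 1), max_eq_left (by linarith : r ≤ r + 1)] at h2
      rw [measureReal_sdiff (ball_subset_ball (by linarith)) measurableSet_ball,
        hball _ (by linarith), hball _ hr]
      have := mul_le_mul_of_nonneg_left h2 hω0
      linarith
    have hcm : MeasurableSet (ball (0 : EuclideanSpace ℝ (Fin n)) r)ᶜ := measurableSet_ball.compl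
    calc _ ≤ ∫ x in {x | φ x < U x}, (ball 0 r)ᶜ.indicator (fun _ ↦ 2 ^ p + Lam) x := by
          refine setIntegral_mono (iφ.add iWφ) ((integrableOn_const hSfin).indicator hcm) fun x ↦ ?_
          by_cases hx : x ∈ ball (0 : EuclideanSpace ℝ (Fin n)) r
          · have : φ =ᶠ[𝓝 x] fun _ ↦ -1 := by
              filter_upwards [isOpen_ball.mem_nhds hx] with y hy using hφin y hy
            simp [hx, this.fderiv_eq, hφin x hx, hp.ne', hW.2.2.2.2.1]
          · rw [indicator_of_mem (by exact hx)]
            refine add_le_add (Real.rpow_le_rpow (norm_nonneg _) ?_ hp.le)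
              (hW.le_const hm hLam (hφ1 x))
            simpa using norm_fderiv_le_of_lipschitz ℝ hφ (x₀ := x)
      _ = (2 ^ p + Lam) * volume.real ({x | φ x < U x} ∩ (ball 0 r)ᶜ) := by
          rw [setIntegral_indicator hcm, setIntegral_const, smul_eq_mul, mul_comm]
      _ ≤ _ := by
          refine mul_le_mul_of_nonneg_left (le_trans ?_ hsh) (by positivity)
          exact measureReal_mono (fun x hx ↦ ⟨hS hx.1, hx.2⟩)
            (measure_ne_top_of_subset sdiff_subset measure_ball_lt_top.ne)
  rw [← hT]
  have h1 := (hlow.trans hmin).trans hup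
  have h2 : volume.real T ≤ (2 ^ p + Lam) * (ω * n * (r + 1) ^ (n - 1)) / c := by
    rw [le_div_iff₀ hc0]; linarith
  have h3 : 0 ≤ (r + 1) ^ (n - 1) := by positivity
  calc _ ≤ _ := h2
    _ = (2 ^ p + Lam) * (ω * n) / c * (r + 1) ^ (n - 1) := by ring
    _ ≤ _ := by linarith

end

/-- Density estimate for minimizers with a general degenerate double-well potential
(Theorem 3.1 in the paper). -/
theorem density_estimate_minimizers_general_potential
    (n : ℕ) (hn : 2 ≤ n) (p m lam Lam : ℝ)
    (hp : 1 < p) (hpm : p < m) (hlam : 0 < lam) (hlL : lam ≤ Lam) :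
    ∃ δ > (0 : ℝ), ∃ R₀ > (0 : ℝ),
      ∀ W : ℝ → ℝ, IsAdmissiblePotential m lam Lam W →
      ∀ Ω : Set (EuclideanSpace ℝ (Fin n)), IsOpen Ω →
        (0 : EuclideanSpace ℝ (Fin n)) ∈ Ω →
      ∀ u : EuclideanSpace ℝ (Fin n) → ℝ,
        (∀ x, u x ∈ Icc (-1 : ℝ) 1) → LocLipOn Ω u → IsMinOfJW p W Ω u →
        u 0 = 0 →
        ∀ R : ℝ, R₀ ≤ R → ball (0 : EuclideanSpace ℝ (Fin n)) R ⊆ Ω →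
          ENNReal.ofReal (δ * R ^ n) ≤
            volume (ball (0 : EuclideanSpace ℝ (Fin n)) R ∩ {x | 0 ≤ u x}) := by
  have hLam : 0 < Lam := hlam.trans_le hlL
  have hm : 0 < m := by linarith
  obtain ⟨e, he, hgrow⟩ := exists_mul_pow_le_volume hn hp hpm hlam hLam
  obtain ⟨C, hC, hinter⟩ := exists_volume_intermediate_le n (by linarith : 0 < p) hm hlam hLam
  refine ⟨(e / 4) ^ n / 2, by positivity, 8 + 2 * C / (e / 4) ^ n, by positivity,
    fun W hW Ω _ _ u hu hL hmin hu0 R hR hRΩ ↦ ?_⟩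
  have hR8 : 8 ≤ R := by
    have : 0 ≤ 2 * C / (e / 4) ^ n := by positivity
    linarith
  have hRC : 2 * C ≤ (e / 4) ^ n * R := by
    rw [← div_le_iff₀' (by positivity)]
    linarith
  obtain ⟨U, hUL, hU1, hUu, hsub⟩ := hmin.exists_isSubminimal (by linarith)
    (hW.continuousOn hm hlam) hu hL (r := R / 2)
    ((closedBall_subset_ball (by linarith)).trans hRΩ)
  have hU0 : U 0 = 0 := (hUu 0 (mem_closedBall_self (by linarith))).trans hu0
  obtain ⟨N, hN1, hN2, hN3⟩ : ∃ N : ℕ, 1 ≤ N ∧ (N : ℝ) + 1 ≤ R / 2 ∧ R / 4 ≤ N := by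
    have h1 := Nat.floor_le (by linarith : 0 ≤ R / 2 - 1)
    have h2 := Nat.lt_floor_add_one (R / 2 - 1)
    refine ⟨⌊R / 2 - 1⌋₊, ?_, by linarith, by linarith⟩
    exact Nat.le_floor (by norm_num; linarith)
  have h1 := hgrow W hW U hUL hU1 hU0 N hN1 (hsub.mono (by linarith))
  have h2 := hinter W hW U hUL hU1 N (by exact_mod_cast hN1) (hsub.mono hN2)
  have hsubset : {x | -(1 / 2) < U x} ∩ ball 0 (N : ℝ) ⊆
      (ball 0 R ∩ {x | 0 ≤ u x}) ∪ ({x | -(1 / 2) < U x ∧ U x < 0} ∩ ball 0 (N : ℝ)) := by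
    rintro x ⟨hx1, hx2⟩
    rcases lt_or_ge (U x) 0 with h | h
    · exact Or.inr ⟨⟨hx1, h⟩, hx2⟩
    · have hx3 := mem_ball_zero_iff.1 hx2
      refine Or.inl ⟨mem_ball_zero_iff.2 (by linarith), ?_⟩
      rw [hUu x (mem_closedBall_zero_iff.2 (by linarith))] at h
      exact h
  have hfin : volume (ball 0 R ∩ {x | 0 ≤ u x}) ≠ ⊤ :=
    measure_ne_top_of_subset inter_subset_left measure_ball_lt_top.ne
  have h3 := (measureReal_mono hsubset (measure_union_ne_top hfin
    (measure_ne_top_of_subset inter_subset_right measure_ball_lt_top.ne))).trans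
    (measureReal_union_le _ _)
  rw [← ofReal_measureReal hfin]
  refine ENNReal.ofReal_le_ofReal ?_
  have h4 : (e / 4) ^ n * R ^ n ≤ (e * N) ^ n := by
    rw [← mul_pow]
    refine pow_le_pow_left₀ (by positivity) ?_ n
    have := mul_le_mul_of_nonneg_left hN3 he.le
    linarith
  have h5 : C * ((N : ℝ) + 1) ^ (n - 1) ≤ (e / 4) ^ n / 2 * R ^ n := by
    calc C * ((N : ℝ) + 1) ^ (n - 1) ≤ (e / 4) ^ n * R / 2 * R ^ (n - 1) := by
          refine mul_le_mul (by linarith) ?_ (by positivity) (by positivity)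
          exact pow_le_pow_left₀ (by positivity) (by linarith) _
      _ = _ := by
          rw [← mul_pow_sub_one (by omega : n ≠ 0) R]; ring
  linarith
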